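/- arXiv:1007.3401 — 2 statements merged into one kernel-verified Lean document; each statement's English description precedes it below -/
import Mathlib

section
/- Let β ∈ (2, 5/2] and ν > 0. For every initial condition (x_n)_{n≥1} with x_n ≥ 0 for all n ≥ 1 and Σ_{n=1}^∞ x_n² < ∞, there exists a unique weak solution X = (X_n)_{n≥1} of the viscous dyadic model on [0,∞) with X_n(0) = x_n, and this solution is smooth: for every γ > 0 and every t > 0 one has sup_{n≥1} (λ_n^γ X_n(t)) < ∞. -/
/-- The dyadic frequencies: `λ_0 = 0`, `λ_n = 2^n` for `n ≥ 1`. -/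
noncomputable def lam (n : ℕ) : ℝ := if n = 0 then 0 else 2 ^ n

/-- `X` is a weak solution of the viscous dyadic model with parameter `β` and
viscosity `ν` on the interval `I`. -/
def IsViscousSolution (β ν : ℝ) (I : Set ℝ) (X : ℕ → ℝ → ℝ) : Prop :=
  ∀ n, 1 ≤ n → ∀ t ∈ I, HasDerivWithinAt (X n)
    (-ν * lam n ^ 2 * X n t + lam (n - 1) ^ β * (X (n - 1) t) ^ 2
      - lam n ^ β * X n t * X (n + 1) t) I t

open Filter Topology

/-- A finite family of differentiable functions which start nonnegative, and each of which has
positive derivative whenever it vanishes while the others are nonnegative, stays nonnegative. -/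
theorem nonneg_of_deriv_pos_on_boundary {ι : Type*} [Finite ι] {t₀ T : ℝ}
    {φ φ' : ι → ℝ → ℝ}
    (hd : ∀ i, ∀ t ∈ Set.Icc t₀ T, HasDerivWithinAt (φ i) (φ' i t) (Set.Icc t₀ T) t)
    (h0 : ∀ i, 0 ≤ φ i t₀)
    (hb : ∀ i, ∀ t ∈ Set.Icc t₀ T, (∀ j, 0 ≤ φ j t) → φ i t = 0 → 0 < φ' i t) :
    ∀ i, ∀ t ∈ Set.Icc t₀ T, 0 ≤ φ i t := by
  have hcont : ∀ i, ContinuousOn (φ i) (Set.Icc t₀ T) := fun i t ht =>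
    (hd i t ht).continuousWithinAt
  have key : Set.Icc t₀ T ⊆ {t | t ∈ Set.Icc t₀ T ∧ ∀ i, 0 ≤ φ i t} := by
    rcases lt_or_ge T t₀ with hT | hT
    · simp [Set.Icc_eq_empty (not_le.mpr hT)]
    refine IsClosed.Icc_subset_of_forall_exists_gt (a := t₀) (b := T) ?_ ⟨⟨le_rfl, hT⟩, h0⟩ ?_
    · have : {t | t ∈ Set.Icc t₀ T ∧ ∀ i, 0 ≤ φ i t} ∩ Set.Icc t₀ T
          = Set.Icc t₀ T ∩ ⋂ i, (Set.Icc t₀ T ∩ φ i ⁻¹' Set.Ici 0) := by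
        ext t
        simp only [Set.mem_inter_iff, Set.mem_ofPred_eq, Set.mem_iInter, Set.mem_preimage,
          Set.mem_Ici]
        exact ⟨fun h => ⟨h.2, fun i => ⟨h.2, h.1.2 i⟩⟩, fun h => ⟨⟨h.1, fun i => (h.2 i).2⟩, h.1⟩⟩
      rw [this]
      exact isClosed_Icc.inter (isClosed_iInter fun i =>
        (hcont i).preimage_isClosed_of_isClosed isClosed_Icc isClosed_Ici)
    · rintro t ⟨⟨htI, htφ⟩, ht⟩ y hy
      have hnhds : 𝓝[>] t ≤ 𝓝[Set.Icc t₀ T] t := by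
        rw [← nhdsWithin_Ioo_eq_nhdsGT ht.2]
        exact nhdsWithin_mono _ fun z hz => ⟨ht.1.trans hz.1.le, hz.2.le⟩
      have hev : ∀ i, ∀ᶠ z in 𝓝[>] t, 0 ≤ φ i z := by
        intro i
        rcases (htφ i).eq_or_lt with hz | hz
        · have hpos := hb i t htI htφ hz.symm
          have hder : HasDerivWithinAt (φ i) (φ' i t) (Set.Ioi t) t :=
            (hd i t htI).mono_of_mem_nhdsWithin (hnhds self_mem_nhdsWithin)
          have hs := (hasDerivWithinAt_iff_tendsto_slope' (by simp)).1 hder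
          filter_upwards [hs.eventually (lt_mem_nhds hpos), self_mem_nhdsWithin] with z hz1 hz2
          have hzt : 0 < z - t := sub_pos.mpr hz2
          rw [slope_def_field, ← hz, sub_zero] at hz1
          exact ((div_pos_iff_of_pos_right hzt).1 hz1).le
        · have := (hcont i t htI).mono_left hnhds
          filter_upwards [this.eventually (lt_mem_nhds hz)] with z hz using hz.le
      have hI : ∀ᶠ z in 𝓝[>] t, z ∈ Set.Ioc t (min y T) := by
        have : t < min y T := lt_min hy ht.2
        exact Ioc_mem_nhdsGT this
      obtain ⟨z, hz1, hz2⟩ := ((Filter.eventually_all.2 hev).and hI).exists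
      exact ⟨z, ⟨⟨ht.1.trans hz2.1.le, hz2.2.trans (min_le_right _ _)⟩, hz1⟩, hz2.1,
        hz2.2.trans (min_le_left _ _)⟩
  exact fun i t ht => (key ht).2 i

/-- A solution of `f' = -a f + b` with `b ≥ 0` and nonnegative initial value is nonnegative. -/
theorem nonneg_of_linear_ode {t₀ T : ℝ} {f a b : ℝ → ℝ}
    (hd : ∀ t ∈ Set.Icc t₀ T, HasDerivWithinAt f (-a t * f t + b t) (Set.Icc t₀ T) t)
    (ha : ContinuousOn a (Set.Icc t₀ T)) (hb : ∀ t ∈ Set.Icc t₀ T, 0 ≤ b t)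
    (h0 : 0 ≤ f t₀) : ∀ t ∈ Set.Icc t₀ T, 0 ≤ f t := by
  obtain ⟨C, hC⟩ := isCompact_Icc.exists_bound_of_continuousOn ha
  have key : ∀ ε > 0, ∀ t ∈ Set.Icc t₀ T, 0 ≤ f t + ε * Real.exp ((C + 1) * t) := by
    intro ε hε
    have := nonneg_of_deriv_pos_on_boundary (ι := Unit) (t₀ := t₀) (T := T)
      (φ := fun _ t => f t + ε * Real.exp ((C + 1) * t))
      (φ' := fun _ t => (-a t * f t + b t) + ε * (Real.exp ((C + 1) * t) * (C + 1)))
      (fun _ t ht => (hd t ht).add ((((hasDerivAt_id t).const_mul (C + 1)).exp.const_mul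
        ε).hasDerivWithinAt.congr_deriv (by simp)))
      (fun _ => by positivity) ?_
    · exact this ()
    · intro _ t ht _ hz
      have he := Real.exp_pos ((C + 1) * t)
      have hf : f t = -(ε * Real.exp ((C + 1) * t)) := by linarith
      have hCt := abs_le.1 (hC t ht)
      have hbt := hb t ht
      rw [hf]
      have : 0 < ε * Real.exp ((C + 1) * t) := by positivity
      nlinarith
  intro t ht
  refine le_of_forall_pos_le_add fun δ hδ => ?_
  have := key (δ / Real.exp ((C + 1) * t)) (by positivity) t ht
  rwa [div_mul_cancel₀ _ (Real.exp_ne_zero _)] at this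

/-- A function with nonpositive derivative on `[t₀, T]` is bounded by its initial value. -/
theorem le_initial_of_deriv_nonpos {t₀ T : ℝ} {f f' : ℝ → ℝ}
    (hd : ∀ t ∈ Set.Icc t₀ T, HasDerivWithinAt f (f' t) (Set.Icc t₀ T) t)
    (hf' : ∀ t ∈ Set.Icc t₀ T, f' t ≤ 0) : ∀ t ∈ Set.Icc t₀ T, f t ≤ f t₀ := by
  intro t ht
  have hanti : AntitoneOn f (Set.Icc t₀ T) := by
    refine antitoneOn_of_hasDerivWithinAt_nonpos (f' := f') (convex_Icc _ _)
      (fun t ht => (hd t ht).continuousWithinAt) (fun t ht => ?_) fun t ht => ?_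
    · exact (hd t (interior_subset ht)).mono interior_subset
    · exact hf' t (interior_subset ht)
  exact hanti ⟨le_rfl, ht.1.trans ht.2⟩ ht ht.1

/-- Global existence for a `C¹` vector field in finite dimension which does not increase
the norm. -/
theorem exists_solution_of_inner_nonpos {E : Type*} [NormedAddCommGroup E]
    [InnerProductSpace ℝ E] [FiniteDimensional ℝ E] {v : E → E} (hv : ContDiff ℝ 1 v)
    (hinner : ∀ x, inner ℝ x (v x) ≤ 0) (x₀ : E) {T : ℝ} (hT : 0 ≤ T) :
    ∃ α : ℝ → E, α 0 = x₀ ∧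
      ∀ t ∈ Set.Icc 0 T, HasDerivWithinAt α (v (α t)) (Set.Icc 0 T) t := by
  let χ : ContDiffBump (0 : E) := ⟨‖x₀‖ + 1, ‖x₀‖ + 2, by positivity, by linarith⟩
  let w : E → E := fun x => χ x • v x
  have hw : ContDiff ℝ 1 w := χ.contDiff.smul hv
  have hsupp : HasCompactSupport w := χ.hasCompactSupport.smul_right
  obtain ⟨K, hK⟩ := hw.lipschitzWith_of_hasCompactSupport hsupp one_ne_zero
  obtain ⟨B, hB⟩ := hw.continuous.bounded_above_of_compact_support hsupp
  lift B to NNReal using (norm_nonneg _).trans (hB 0)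
  have hPL : IsPicardLindelof (fun _ : ℝ => w) (tmin := 0) (tmax := T)
      ⟨0, ⟨le_rfl, hT⟩⟩ x₀ (B * T.toNNReal) 0 B K := by
    refine IsPicardLindelof.of_time_independent (fun x _ => hB x) hK.lipschitzOnWith ?_
    simp [hT]
  obtain ⟨α, hα0, hα⟩ := hPL.exists_eq_forall_mem_Icc_hasDerivWithinAt₀
  refine ⟨α, hα0, fun t ht => ?_⟩
  have hnorm : ‖α t‖ ^ 2 ≤ ‖α 0‖ ^ 2 := by
    refine le_initial_of_deriv_nonpos (f := fun t => ‖α t‖ ^ 2)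
      (fun t ht => (hα t ht).norm_sq) (fun t _ => ?_) t ht
    simp only [w, inner_smul_right]
    have := mul_nonneg (χ.nonneg (x := α t)) (neg_nonneg.2 (hinner (α t)))
    linarith
  have hle : ‖α t‖ ≤ ‖x₀‖ := by
    have h0 : α 0 = x₀ := hα0
    rw [h0] at hnorm
    exact (pow_le_pow_iff_left₀ (norm_nonneg _) (norm_nonneg _) two_ne_zero).1 hnorm
  have hone : χ (α t) = 1 := χ.one_of_mem_closedBall (by
    simp only [Metric.mem_closedBall, dist_zero_right, χ]; linarith)
  simpa [w, hone] using hα t ht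

/-- The vector field points inwards on the upper barrier `2 d y = x + (4/5) d` of the region
trapping two consecutive rescaled modes. -/
theorem upper_barrier {R q d x y z κ u : ℝ} (hR1 : 3.996 ≤ R) (hR2 : R ≤ 4) (hq : 1 ≤ q)
    (hd1 : 1 / 4 ≤ d) (hd2 : d ≤ 0.502) (hκ : 0 < κ) (hx : 0 ≤ x) (hz : 0 ≤ z)
    (hxy : x + 4 / 5 * d - 2 * d * y = 0) (hyz : 1.001 * d * y ^ 2 ≤ z + q * κ) :
    0 < (-κ * x + d * u ^ 2 - x * y) - 2 * d * (R * (-(q * κ) * y + d * x ^ 2 - y * z)) := by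
  have hxe : x = 2 * d * (y - 2 / 5) := by linarith
  have hy0 : 2 / 5 ≤ y := by
    by_contra h
    push Not at h
    nlinarith only [h, hxe, hx, hd1]
  have hw : κ ≤ z + q * κ := by nlinarith only [hz, hq, hκ]
  set w := z + q * κ with hwdef
  have hpoly : 0 < 3.996 * d * y ^ 3 - d * y ^ 2 * 1.001 * (y - 2 / 5)
      - (y - 2 / 5) * y - 16 * d ^ 3 * (y - 2 / 5) ^ 2 := by
    have hd3 : d ^ 3 ≤ (d - 1 / 4) * 0.442 + 1 / 64 := by
      nlinarith only [hd1, hd2, mul_nonneg (sub_nonneg.2 hd1) (sub_nonneg.2 hd2)]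
    have h1 : 0 < 3.996 * (1 / 4) * y ^ 3 - (1 / 4) * y ^ 2 * 1.001 * (y - 2 / 5)
      - (y - 2 / 5) * y - 16 * (1 / 64) * (y - 2 / 5) ^ 2 := by
      nlinarith only [hy0, sq_nonneg (y - 0.57),
        mul_nonneg (sub_nonneg.2 hy0) (sq_nonneg (y - 0.57))]
    have h2 : 0 ≤ 3.996 * y ^ 3 - y ^ 2 * 1.001 * (y - 2 / 5) - 16 * 0.442 * (y - 2 / 5) ^ 2 := by
      nlinarith only [hy0, sq_nonneg (y - 1),
        mul_nonneg (sub_nonneg.2 hy0) (sq_nonneg (y - 1))]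
    have h3 := mul_nonneg (sub_nonneg.2 hd1) h2
    have h4 := mul_le_mul_of_nonneg_right hd3 (sq_nonneg (y - 2 / 5))
    linarith only [h1, h3, h4]
  have hwy : 1.001 * d * y ^ 2 * (R * y - (y - 2 / 5)) ≤ w * (R * y - (y - 2 / 5)) :=
    mul_le_mul_of_nonneg_right hyz (by nlinarith only [hR1, hy0])
  have hκy : (y - 2 / 5) * κ ≤ (y - 2 / 5) * w := mul_le_mul_of_nonneg_left hw (by linarith)
  have hR3 : 3.996 * (d * y ^ 3) ≤ R * (d * y ^ 3) :=
    mul_le_mul_of_nonneg_right hR1 (by positivity)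
  have hR4 : R * (4 * d ^ 3 * (y - 2 / 5) ^ 2) ≤ 4 * (4 * d ^ 3 * (y - 2 / 5) ^ 2) :=
    mul_le_mul_of_nonneg_right hR2 (by positivity)
  have hmain : 0 < R * (w * y - d * x ^ 2) - (y - 2 / 5) * (κ + y) := by
    rw [hxe]
    have hdy : 0 ≤ d * y ^ 3 := by positivity
    linarith only [hpoly, hwy, hκy, hR3, hR4, hdy]
  have hu : 0 ≤ d * u ^ 2 := by positivity
  have : (-κ * x + d * u ^ 2 - x * y) - 2 * d * (R * (-(q * κ) * y + d * x ^ 2 - y * z))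
      = d * u ^ 2 + 2 * d * (R * (w * y - d * x ^ 2) - (y - 2 / 5) * (κ + y)) := by
    rw [hwdef, hxe]; ring
  rw [this]
  have := mul_pos (show 0 < 2 * d by linarith) hmain
  linarith

/-- The damping and the flux out of `y` on the lower barrier are largest when `κ` is
negligible. -/
theorem lower_barrier_flux {q d x y z κ : ℝ} (hq : q ≤ 1.001) (hd1 : 1 / 4 ≤ d)
    (hd2 : d ≤ 0.502) (hκ : 0 < κ) (hy : 0 ≤ y) (hyz : 0 ≤ y + 4 / 5 * d - 2 * d * z)
    (hxy : y + κ - 1.001 * d * x ^ 2 = 0) :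
    y * (q * κ + z) ≤ 1.001 * d * x ^ 2 * (0.5005 * x ^ 2 + 2 / 5) - 2 / 5 * κ := by
  refine le_of_mul_le_mul_left ?_ (show 0 < d by linarith)
  have h1 : y * (2 * d * z) ≤ y * (y + 4 / 5 * d) := by gcongr; linarith
  have h2 : y * (q * κ) ≤ y * (1.001 * κ) := by gcongr
  have h3 : 0 ≤ y * κ := by positivity
  have h4 : 0 ≤ κ ^ 2 := by positivity
  have hs : 1.001 * d * x ^ 2 = y + κ := by linarith
  have hs2 : d * (1.001 * d * x ^ 2 * (0.5005 * x ^ 2 + 2 / 5)) =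
      (y + κ) * ((y + κ) / 2 + 2 / 5 * d) := by rw [hs]; linear_combination (y + κ) / 2 * hs
  have h5 := mul_le_mul_of_nonneg_left h2 (show 0 ≤ d by linarith)
  have h6 := mul_le_mul_of_nonneg_right hd2 h3
  linarith

/-- The polynomial inequality behind the lower barrier for large `x`. -/
theorem lower_barrier_poly {x : ℝ} (hx : 1 / 2 ≤ x) (hx1 : x ≤ 1) :
    0 < 3.996 * (0.5996 - 0.50101 * x ^ 2) * x - 2.002 * (0.502 * (1 - x ^ 3)) := by
  nlinarith [mul_nonneg (sub_nonneg.2 hx) (sub_nonneg.2 hx1),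
    mul_nonneg (mul_nonneg (sub_nonneg.2 hx) (sub_nonneg.2 hx1)) (show 0 ≤ x by linarith)]

/-- The vector field points inwards on the lower barrier `y + κ = 1.001 d x²` of the region
trapping two consecutive rescaled modes. -/
theorem lower_barrier {R q d x y z κ κ' u : ℝ} (hR1 : 3.996 ≤ R) (hq : q ≤ 1.001)
    (hd1 : 1 / 4 ≤ d) (hd2 : d ≤ 0.502) (hκ : 0 < κ) (hκ' : κ' ≤ κ)
    (hx0 : 0 ≤ x) (hx1 : x ≤ 1) (hy : 0 ≤ y) (hu0 : 0 ≤ u) (hu1 : u ≤ 1)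
    (hyz : 0 ≤ y + 4 / 5 * d - 2 * d * z) (hux : 1.001 * d * u ^ 2 ≤ x + κ')
    (hxy : y + κ - 1.001 * d * x ^ 2 = 0) :
    0 < R * (-(q * κ) * y + d * x ^ 2 - y * z)
      - 1.001 * d * (2 * x * (-κ * x + d * u ^ 2 - x * y)) := by
  have hx : 0 < x := by
    rcases hx0.eq_or_lt with h | h
    · rw [← h] at hxy; linarith
    · exact h
  have hκe : κ = 1.001 * d * x ^ 2 - y := by linarith
  have hflux' := lower_barrier_flux hq hd1 hd2 hκ hy hyz hxy
  have hRflux := mul_le_mul_of_nonneg_left hflux' (show 0 ≤ R by linarith)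
  have hcube : κ * x + x * y = 1.001 * d * x ^ 3 := by rw [hκe]; ring
  suffices h : 0 < R * (d * x ^ 2 - 1.001 * d * x ^ 2 * (0.5005 * x ^ 2 + 2 / 5)) + R * (2 / 5 * κ)
      - 2.002 * d * x * (d * u ^ 2 - 1.001 * d * x ^ 3) by
    rw [← hcube] at h
    linarith only [h, hRflux]
  have hP : 0 < 0.5996 - 0.50101 * x ^ 2 := by linarith [pow_le_one₀ hx0 hx1 (n := 2)]
  have hP2 : 3.996 * (0.5996 - 0.50101 * x ^ 2) ≤ R * (1 - 1.001 * (0.5005 * x ^ 2 + 2 / 5)) := by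
    refine mul_le_mul hR1 ?_ hP.le (by linarith)
    linarith only [sq_nonneg x]
  rcases le_total x (1 / 2) with hxh | hxh
  · have h1 : 2.002 * d * x * (d * u ^ 2) ≤ 2 * d * x * (x + κ) := by
      linarith only [mul_le_mul_of_nonneg_left (hux.trans (by linarith : x + κ' ≤ x + κ))
        (show 0 ≤ 2 * d * x by positivity)]
    have h2 : 2 * d * x * κ ≤ R * (2 / 5) * κ :=
      mul_le_mul_of_nonneg_right (by nlinarith only [hxh, hx0, hd1, hd2, hR1]) hκ.le
    have h3 : 0 < R * (1 - 1.001 * (0.5005 * x ^ 2 + 2 / 5)) - 2 + 2 * d * x ^ 2 := by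
      have h5 : x ^ 2 ≤ 1 / 4 := by nlinarith only [hx0, hxh]
      have h6 : 1 / 4 * x ^ 2 ≤ d * x ^ 2 := by gcongr
      linarith
    have h4 := mul_pos (show 0 < d * x ^ 2 by positivity) h3
    have h9 : 0 ≤ d ^ 2 * x ^ 4 := by positivity
    linarith only [h1, h2, h4, h9]
  · have h1 : d * u ^ 2 ≤ d := mul_le_of_le_one_right (by linarith) (pow_le_one₀ hu0 hu1)
    have h3 : 0 < R * (1 - 1.001 * (0.5005 * x ^ 2 + 2 / 5)) * x - 2.002 * d * (1 - x ^ 3) := by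
      have h5 : d * (1 - x ^ 3) ≤ 0.502 * (1 - x ^ 3) :=
        mul_le_mul_of_nonneg_right hd2 (sub_nonneg.2 (pow_le_one₀ hx0 hx1))
      have h6 := mul_le_mul_of_nonneg_right hP2 hx0
      linarith only [lower_barrier_poly hxh hx1, h5, h6]
    have h4 := mul_pos (show 0 < d * x by positivity) h3
    have h7 : 2.002 * d * x * (d * u ^ 2) ≤ 2.002 * d * x * d := by gcongr
    have h8 : 0 ≤ R * (2 / 5 * κ) := by positivity
    have h9 : 0 ≤ d ^ 2 * x ^ 4 := by positivity
    linarith only [h4, h7, h8, h9]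

/-- Rescaled modes of a Galerkin truncation which are initially small stay below `1`. -/
theorem rescaled_modes_le_one {N : ℕ} {T R q d : ℝ} {r κ : ℕ → ℝ} {Y : ℕ → ℝ → ℝ}
    (hR1 : 3.996 ≤ R) (hR2 : R ≤ 4) (hq1 : 1 ≤ q) (hq2 : q ≤ 1.001)
    (hd1 : 1 / 4 ≤ d) (hd2 : d ≤ 0.502) (hr : ∀ n, 1 ≤ n → 0 < r n)
    (hrR : ∀ n, 1 ≤ n → r (n + 1) = R * r n) (hκ : ∀ n, 1 ≤ n → 0 < κ n)
    (hκq : ∀ n, 1 ≤ n → κ (n + 1) = q * κ n)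
    (hY0 : ∀ t, Y 0 t = 0) (hYN : ∀ t, Y (N + 2) t = 0)
    (hpos : ∀ n, ∀ t ∈ Set.Icc 0 T, 0 ≤ Y n t)
    (hode : ∀ n, 1 ≤ n → n ≤ N + 1 → ∀ t ∈ Set.Icc 0 T, HasDerivWithinAt (Y n)
      (r n * (-κ n * Y n t + d * Y (n - 1) t ^ 2 - Y n t * Y (n + 1) t)) (Set.Icc 0 T) t)
    (hκN : 1.001 * d ≤ κ (N + 1))
    (hinit : ∀ n, 1 ≤ n → n ≤ N + 1 → Y n 0 ≤ 2 / 5)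
    (hinit' : ∀ n, 1 ≤ n → n ≤ N + 1 → 1.001 * d * Y n 0 ^ 2 ≤ κ n) :
    ∀ n, 1 ≤ n → n ≤ N + 1 → ∀ t ∈ Set.Icc 0 T, Y n t ≤ 1 := by
  rcases lt_or_ge T 0 with hT | hT
  · simp [Set.Icc_eq_empty (not_le.mpr hT)]
  have h0T : (0 : ℝ) ∈ Set.Icc 0 T := ⟨le_rfl, hT⟩
  let F : ℕ → ℝ → ℝ := fun n t =>
    r n * (-κ n * Y n t + d * Y (n - 1) t ^ 2 - Y n t * Y (n + 1) t)
  let φ : Fin (N + 1) ⊕ Fin N ⊕ Fin N → ℝ → ℝ := Sum.elim (fun i t => 1 - Y (i + 1) t)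
    (Sum.elim (fun i t => Y (i + 1) t + 4 / 5 * d - 2 * d * Y (i + 2) t)
      (fun i t => Y (i + 2) t + κ (i + 1) - 1.001 * d * Y (i + 1) t ^ 2))
  let φ' : Fin (N + 1) ⊕ Fin N ⊕ Fin N → ℝ → ℝ := Sum.elim (fun i t => -F (i + 1) t)
    (Sum.elim (fun i t => F (i + 1) t - 2 * d * F (i + 2) t)
      (fun i t => F (i + 2) t - 1.001 * d * (2 * Y (i + 1) t * F (i + 1) t)))
  have main : ∀ i, ∀ t ∈ Set.Icc 0 T, 0 ≤ φ i t := by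
    refine nonneg_of_deriv_pos_on_boundary (φ' := φ') ?_ ?_ ?_
    · rintro (i | i | i) t ht
      · exact (hode (i + 1) (by omega) (by omega) t ht).const_sub 1
      · exact ((hode (i + 1) (by omega) (by omega) t ht).add_const _).sub
          ((hode (i + 2) (by omega) (by omega) t ht).const_mul _)
      · refine ((hode (i + 2) (by omega) (by omega) t ht).add_const _).sub
          ((((hode (i + 1) (by omega) (by omega) t ht).pow 2).const_mul _).congr_deriv ?_)
        simp [F]
    · rintro (i | i | i)
      · have := hinit (i + 1) (by omega) (by omega)
        simp only [φ, Sum.elim_inl]; linarith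
      · have h1 := hpos (i + 1) 0 h0T
        have h2 := hinit (i + 2) (by omega) (by omega)
        simp only [φ, Sum.elim_inl, Sum.elim_inr]; nlinarith
      · have h1 := hpos (i + 2) 0 h0T
        have h2 := hinit' (i + 1) (by omega) (by omega)
        simp only [φ, Sum.elim_inr]; linarith
    · intro i t ht hφ
      have hA : ∀ n, n ≤ N + 1 → Y n t ≤ 1 := by
        rintro (_ | n) hn
        · simp [hY0]
        · have := hφ (Sum.inl ⟨n, by omega⟩)
          simp only [φ, Sum.elim_inl] at this
          linarith
      have hB : ∀ n, 1 ≤ n → n ≤ N + 1 → 0 ≤ Y n t + 4 / 5 * d - 2 * d * Y (n + 1) t := by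
        intro n h1 hn
        obtain ⟨n, rfl⟩ := Nat.exists_eq_add_of_le' h1
        rcases (Nat.lt_succ_iff.1 hn).eq_or_lt with rfl | hn'
        · have := hpos (n + 1) t ht
          rw [hYN]; linarith
        · exact hφ (Sum.inr (Sum.inl ⟨n, by omega⟩))
      have hC : ∀ n, 1 ≤ n → n ≤ N + 1 → 1.001 * d * Y n t ^ 2 ≤ Y (n + 1) t + κ n := by
        intro n h1 hn
        obtain ⟨n, rfl⟩ := Nat.exists_eq_add_of_le' h1
        rcases (Nat.lt_succ_iff.1 hn).eq_or_lt with rfl | hn'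
        · have := pow_le_one₀ (hpos (n + 1) t ht) (hA _ hn) (n := 2)
          rw [hYN]; nlinarith
        · have := hφ (Sum.inr (Sum.inr ⟨n, by omega⟩))
          simp only [φ, Sum.elim_inr] at this
          linarith
      rcases i with i | i | i
      · intro hz
        simp only [φ, Sum.elim_inl] at hz
        have hY : Y (i + 1) t = 1 := by linarith
        have hc := hC (i + 1) (by omega) (by omega)
        have hu := pow_le_one₀ (hpos i t ht) (hA i (by omega)) (n := 2)
        have hrn := hr (i + 1) (by omega)
        simp only [φ', Sum.elim_inl, F, hY, Nat.add_sub_cancel] at hc ⊢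
        rw [← mul_neg]
        refine mul_pos hrn ?_
        nlinarith
      · intro hz
        simp only [φ, Sum.elim_inl, Sum.elim_inr] at hz
        have hrn := hr (i + 1) (by omega)
        have hc := hC (i + 2) (by omega) (by omega)
        rw [hκq (i + 1) (by omega)] at hc
        have := upper_barrier (u := Y i t) hR1 hR2 hq1 hd1 hd2 (hκ (i + 1) (by omega))
          (hpos _ t ht) (hpos _ t ht) hz hc
        have := mul_pos hrn this
        simp only [φ', Sum.elim_inl, Sum.elim_inr, F, hrR (i + 1) (by omega),
          hκq (i + 1) (by omega), Nat.add_one_sub_one]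
        linarith
      · intro hz
        simp only [φ, Sum.elim_inr] at hz
        have hrn := hr (i + 1) (by omega)
        obtain ⟨κ', hκ', hux⟩ : ∃ κ' ≤ κ (i + 1), 1.001 * d * Y i t ^ 2 ≤ Y (i + 1) t + κ' := by
          rcases Nat.eq_zero_or_pos (i : ℕ) with hi | hi
          · refine ⟨_, le_rfl, ?_⟩
            have h1 := hpos (i + 1) t ht
            have h2 := hκ (i + 1) (by omega)
            simp only [hi, hY0] at h1 h2 ⊢
            linarith
          · refine ⟨κ i, ?_, hC i hi (by omega)⟩
            rw [hκq i hi]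
            nlinarith [hκ i hi]
        have := lower_barrier hR1 hq2 hd1 hd2 (hκ (i + 1) (by omega)) hκ' (hpos _ t ht)
          (hA (i + 1) (by omega)) (hpos (i + 2) t ht) (hpos i t ht) (hA i (by omega))
          (hB (i + 2) (by omega) (by omega)) hux hz
        have := mul_pos hrn this
        simp only [φ', Sum.elim_inr, F, hrR (i + 1) (by omega),
          hκq (i + 1) (by omega), Nat.add_one_sub_one]
        linarith
  intro n h1 hn t ht
  obtain ⟨n, rfl⟩ := Nat.exists_eq_add_of_le' h1
  have := main (Sum.inl ⟨n, by omega⟩) t ht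
  simp only [φ, Sum.elim_inl] at this
  linarith

theorem lam_zero : lam 0 = 0 := by simp [lam]

theorem lam_of_pos {n : ℕ} (hn : 1 ≤ n) : lam n = 2 ^ n := by
  simp [lam, Nat.one_le_iff_ne_zero.1 hn]

theorem lam_nonneg (n : ℕ) : 0 ≤ lam n := by
  unfold lam; split <;> positivity

theorem lam_pos {n : ℕ} (hn : 1 ≤ n) : 0 < lam n := by
  rw [lam_of_pos hn]; positivity

theorem one_le_lam {n : ℕ} (hn : 1 ≤ n) : 1 ≤ lam n := by
  rw [lam_of_pos hn]; exact one_le_pow₀ one_le_two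

theorem lam_succ {n : ℕ} (hn : 1 ≤ n) : lam (n + 1) = 2 * lam n := by
  rw [lam_of_pos hn, lam_of_pos (by omega)]; ring

/-- The vector field of the viscous dyadic model. -/
noncomputable def dyadicField (β ν : ℝ) (y : ℕ → ℝ) (n : ℕ) : ℝ :=
  -ν * lam n ^ 2 * y n + lam (n - 1) ^ β * y (n - 1) ^ 2 - lam n ^ β * y n * y (n + 1)

/-- `X` solves the first `N` equations of the viscous dyadic model on `[0, T]`. -/
def IsTruncatedSolution (β ν : ℝ) (N : ℕ) (T : ℝ) (X : ℕ → ℝ → ℝ) : Prop :=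
  ∀ n, 1 ≤ n → n ≤ N → ∀ t ∈ Set.Icc 0 T,
    HasDerivWithinAt (X n) (dyadicField β ν (fun k => X k t) n) (Set.Icc 0 T) t

theorem IsViscousSolution.isTruncatedSolution {β ν : ℝ} {X : ℕ → ℝ → ℝ}
    (hX : IsViscousSolution β ν (Set.Ici 0) X) (N : ℕ) (T : ℝ) :
    IsTruncatedSolution β ν N T X := fun n hn _ t ht =>
  (hX n hn t ht.1).mono Set.Icc_subset_Ici_self

theorem IsTruncatedSolution.continuousOn {β ν T : ℝ} {N n : ℕ} {X : ℕ → ℝ → ℝ}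
    (hX : IsTruncatedSolution β ν N T X) (hn : 1 ≤ n) (hnN : n ≤ N) :
    ContinuousOn (X n) (Set.Icc 0 T) := fun t ht => (hX n hn hnN t ht).continuousWithinAt

theorem IsTruncatedSolution.nonneg {β ν T : ℝ} {N n : ℕ} {X : ℕ → ℝ → ℝ}
    (hX : IsTruncatedSolution β ν N T X) (hn : 1 ≤ n) (hnN : n ≤ N)
    (hcont : ContinuousOn (X (n + 1)) (Set.Icc 0 T)) (h0 : 0 ≤ X n 0) :
    ∀ t ∈ Set.Icc 0 T, 0 ≤ X n t := by
  refine nonneg_of_linear_ode (a := fun t => ν * lam n ^ 2 + lam n ^ β * X (n + 1) t)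
    (b := fun t => lam (n - 1) ^ β * X (n - 1) t ^ 2) (fun t ht => ?_) (by fun_prop)
    (fun t _ => ?_) h0
  · refine (hX n hn hnN t ht).congr_deriv ?_
    simp only [dyadicField]; ring
  · have := Real.rpow_nonneg (lam_nonneg (n - 1)) β
    positivity

theorem IsViscousSolution.nonneg {β ν : ℝ} {X : ℕ → ℝ → ℝ}
    (hX : IsViscousSolution β ν (Set.Ici 0) X) (h0 : ∀ n, 1 ≤ n → 0 ≤ X n 0) {n : ℕ}
    (hn : 1 ≤ n) {t : ℝ} (ht : 0 ≤ t) : 0 ≤ X n t :=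
  (hX.isTruncatedSolution (n + 1) t).nonneg hn (by omega)
    ((hX.isTruncatedSolution (n + 1) t).continuousOn (by omega) le_rfl) (h0 n hn) t ⟨ht, le_rfl⟩

theorem sum_mul_dyadicField {β : ℝ} (hβ : β ≠ 0) (ν : ℝ) (y : ℕ → ℝ) (N : ℕ) :
    ∑ n ∈ Finset.range N, 2 * y (n + 1) * dyadicField β ν y (n + 1) =
      -(2 * ν * ∑ n ∈ Finset.range N, lam (n + 1) ^ 2 * y (n + 1) ^ 2)
        - 2 * lam N ^ β * y N ^ 2 * y (N + 1) := by
  induction N with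
  | zero => simp [lam_zero, Real.zero_rpow hβ]
  | succ N ih =>
    rw [Finset.sum_range_succ, ih, Finset.sum_range_succ]
    simp only [dyadicField, Nat.add_sub_cancel]
    ring

theorem sum_mul_dyadicField_sub {β : ℝ} (hβ : β ≠ 0) (ν : ℝ) (x y : ℕ → ℝ) (N : ℕ) :
    ∑ n ∈ Finset.range N, (1 / 2) ^ (n + 1) * (2 * (x (n + 1) - y (n + 1)) *
        (dyadicField β ν x (n + 1) - dyadicField β ν y (n + 1))) =
      -(∑ n ∈ Finset.range N, (1 / 2) ^ (n + 1) * ((x (n + 1) - y (n + 1)) ^ 2 *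
        (2 * ν * lam (n + 1) ^ 2 + lam (n + 1) ^ β * (x (n + 2) + y (n + 2)))))
        - (1 / 2) ^ N * lam N ^ β * ((x N + y N) * (x N - y N) * (x (N + 1) - y (N + 1))) := by
  induction N with
  | zero => simp [lam_zero, Real.zero_rpow hβ]
  | succ N ih =>
    rw [Finset.sum_range_succ, ih, Finset.sum_range_succ]
    simp only [dyadicField, Nat.add_sub_cancel]
    ring

/-- The energy balance of the first `N` modes. -/
theorem IsTruncatedSolution.hasDerivWithinAt_energy {β ν T : ℝ} (hβ : β ≠ 0) {N : ℕ}
    {X : ℕ → ℝ → ℝ} (hX : IsTruncatedSolution β ν N T X) {t : ℝ} (ht : t ∈ Set.Icc 0 T) :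
    HasDerivWithinAt (fun t => ∑ n ∈ Finset.range N, X (n + 1) t ^ 2)
      (-(2 * ν * ∑ n ∈ Finset.range N, lam (n + 1) ^ 2 * X (n + 1) t ^ 2)
        - 2 * lam N ^ β * X N t ^ 2 * X (N + 1) t) (Set.Icc 0 T) t := by
  rw [← sum_mul_dyadicField hβ ν (fun k => X k t)]
  refine HasDerivWithinAt.fun_sum fun n hn => ?_
  have hnN := Finset.mem_range.1 hn
  refine ((hX (n + 1) (by omega) (by omega) t ht).pow 2).congr_deriv ?_
  simp

theorem IsTruncatedSolution.energy_le {β ν T : ℝ} (hβ : β ≠ 0) (hν : 0 < ν) {N : ℕ}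
    {X : ℕ → ℝ → ℝ} (hX : IsTruncatedSolution β ν N T X)
    (hpos : ∀ t ∈ Set.Icc 0 T, 0 ≤ X (N + 1) t) {t : ℝ} (ht : t ∈ Set.Icc 0 T) :
    ∑ n ∈ Finset.range N, X (n + 1) t ^ 2 ≤ ∑ n ∈ Finset.range N, X (n + 1) 0 ^ 2 := by
  refine le_initial_of_deriv_nonpos (f := fun t => ∑ n ∈ Finset.range N, X (n + 1) t ^ 2)
    (fun t ht => hX.hasDerivWithinAt_energy hβ ht) (fun t ht => ?_) t ht
  have h1 := hpos t ht
  have h2 := Real.rpow_nonneg (lam_nonneg N) β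
  have h3 : 0 ≤ 2 * ν * ∑ n ∈ Finset.range N, lam (n + 1) ^ 2 * X (n + 1) t ^ 2 :=
    mul_nonneg (by positivity) (Finset.sum_nonneg fun _ _ => by positivity)
  have h4 : 0 ≤ 2 * lam N ^ β * X N t ^ 2 * X (N + 1) t := by positivity
  linarith

/-- Stability of truncated solutions in a weighted `ℓ²` norm: the error is controlled by the
energy dissipated at the truncation scale. -/
theorem IsTruncatedSolution.weighted_sub_le {β ν T C : ℝ} (hβ : β ≠ 0) (hν : 0 < ν) {N : ℕ}
    (hN : 1 ≤ N) {X Y : ℕ → ℝ → ℝ} (hX : IsTruncatedSolution β ν N T X)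
    (hY : IsTruncatedSolution β ν N T Y)
    (hXpos : ∀ n, 1 ≤ n → n ≤ N + 1 → ∀ t ∈ Set.Icc 0 T, 0 ≤ X n t)
    (hYpos : ∀ n, 1 ≤ n → n ≤ N + 1 → ∀ t ∈ Set.Icc 0 T, 0 ≤ Y n t)
    (hXC : ∀ t ∈ Set.Icc 0 T, X (N + 1) t ≤ C) (hYC : ∀ t ∈ Set.Icc 0 T, Y (N + 1) t ≤ C)
    (h0 : ∀ n, 1 ≤ n → n ≤ N → X n 0 = Y n 0) {t : ℝ} (ht : t ∈ Set.Icc 0 T) :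
    ∑ n ∈ Finset.range N, (1 / 2) ^ (n + 1) * (X (n + 1) t - Y (n + 1) t) ^ 2 ≤
      C / ν * ((1 / 2) ^ N * lam N ^ β / lam N ^ 2) *
        (2 * ∑ n ∈ Finset.range N, X (n + 1) 0 ^ 2) := by
  have hC : 0 ≤ C := (hXpos (N + 1) (by omega) le_rfl t ht).trans (hXC t ht)
  have hlam := lam_pos hN
  have hlamβ : 0 < lam N ^ β := Real.rpow_pos_of_pos hlam β
  set c : ℝ := C / ν * ((1 / 2) ^ N * lam N ^ β / lam N ^ 2) with hc
  have hc0 : 0 ≤ c := by positivity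
  have hcν : c * (ν * lam N ^ 2) = C * ((1 / 2) ^ N * lam N ^ β) := by
    rw [hc]; field_simp
  have hEd : ∀ Z : ℕ → ℝ → ℝ, (∀ t ∈ Set.Icc 0 T, 0 ≤ Z (N + 1) t) → ∀ t ∈ Set.Icc 0 T,
      -(2 * ν * ∑ n ∈ Finset.range N, lam (n + 1) ^ 2 * Z (n + 1) t ^ 2)
        - 2 * lam N ^ β * Z N t ^ 2 * Z (N + 1) t ≤ -(2 * ν * (lam N ^ 2 * Z N t ^ 2)) := by
    intro Z hZ t ht
    have h1 := hZ t ht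
    have h2 : lam N ^ 2 * Z N t ^ 2 ≤
        ∑ n ∈ Finset.range N, lam (n + 1) ^ 2 * Z (n + 1) t ^ 2 := by
      have := Finset.single_le_sum (f := fun n => lam (n + 1) ^ 2 * Z (n + 1) t ^ 2)
        (fun n _ => by positivity) (Finset.mem_range.2 (show N - 1 < N by omega))
      simpa [Nat.sub_add_cancel hN] using this
    have h3 : 0 ≤ 2 * lam N ^ β * Z N t ^ 2 * Z (N + 1) t := by positivity
    have h4 := mul_le_mul_of_nonneg_left h2 (show 0 ≤ 2 * ν by positivity)
    linarith
  have hanti := le_initial_of_deriv_nonpos (t₀ := 0) (T := T)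
    (f := fun t => ∑ n ∈ Finset.range N, (1 / 2) ^ (n + 1) * (X (n + 1) t - Y (n + 1) t) ^ 2
      + c * (∑ n ∈ Finset.range N, X (n + 1) t ^ 2 + ∑ n ∈ Finset.range N, Y (n + 1) t ^ 2))
    (fun t ht => (((HasDerivWithinAt.fun_sum (A' := fun n => (1 / 2) ^ (n + 1) *
        (2 * (X (n + 1) t - Y (n + 1) t) * (dyadicField β ν (fun k => X k t) (n + 1)
          - dyadicField β ν (fun k => Y k t) (n + 1)))) fun n hn => ?_).congr_deriv
        (sum_mul_dyadicField_sub hβ ν (fun k => X k t) (fun k => Y k t) N)).add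
      (((hX.hasDerivWithinAt_energy hβ ht).add (hY.hasDerivWithinAt_energy hβ ht)).const_mul c)))
    (fun t ht => ?_) t ht
  · have hE0 : ∑ n ∈ Finset.range N, Y (n + 1) 0 ^ 2 = ∑ n ∈ Finset.range N, X (n + 1) 0 ^ 2 :=
      Finset.sum_congr rfl fun n hn => by
        rw [h0 (n + 1) (by omega) (by have := Finset.mem_range.1 hn; omega)]
    have hZ0 : ∑ n ∈ Finset.range N, (1 / 2 : ℝ) ^ (n + 1) * (X (n + 1) 0 - Y (n + 1) 0) ^ 2 = 0 :=
      Finset.sum_eq_zero fun n hn => by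
        rw [h0 (n + 1) (by omega) (by have := Finset.mem_range.1 hn; omega)]; simp
    simp only [hE0, hZ0] at hanti
    have h1 : 0 ≤ c * (∑ n ∈ Finset.range N, X (n + 1) t ^ 2
        + ∑ n ∈ Finset.range N, Y (n + 1) t ^ 2) := by positivity
    linarith
  · have hnN : n + 1 ≤ N := by have := Finset.mem_range.1 hn; omega
    refine ((((hX (n + 1) (by omega) hnN t ht).sub
      (hY (n + 1) (by omega) hnN t ht)).pow 2).const_mul _).congr_deriv ?_
    simp
  · have hx := hXpos N hN (by omega) t ht
    have hy := hYpos N hN (by omega) t ht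
    have hx' := hXpos (N + 1) (by omega) le_rfl t ht
    have hy' := hYpos (N + 1) (by omega) le_rfl t ht
    have hxC := hXC t ht
    have hyC := hYC t ht
    have hs : 0 ≤ ∑ n ∈ Finset.range N, (1 / 2) ^ (n + 1) * ((X (n + 1) t - Y (n + 1) t) ^ 2 *
        (2 * ν * lam (n + 1) ^ 2 + lam (n + 1) ^ β * (X (n + 2) t + Y (n + 2) t))) := by
      refine Finset.sum_nonneg fun n hn => ?_
      have hnN : n + 2 ≤ N + 1 := by have := Finset.mem_range.1 hn; omega
      have h1 := hXpos (n + 2) (by omega) hnN t ht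
      have h2 := hYpos (n + 2) (by omega) hnN t ht
      have h3 := Real.rpow_nonneg (lam_nonneg (n + 1)) β
      positivity
    have hflux : -((X N t + Y N t) * (X N t - Y N t) * (X (N + 1) t - Y (N + 1) t)) ≤
        C * (2 * (X N t ^ 2 + Y N t ^ 2)) := by
      have h1 : |(X N t + Y N t) * (X N t - Y N t) * (X (N + 1) t - Y (N + 1) t)| ≤
          (X N t + Y N t) * (X N t + Y N t) * C := by
        rw [abs_mul, abs_mul, abs_of_nonneg (add_nonneg hx hy)]
        gcongr
        · exact abs_le.2 ⟨by linarith, by linarith⟩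
        · exact abs_le.2 ⟨by linarith, by linarith⟩
      have h2 := neg_le_of_abs_le h1
      nlinarith [mul_nonneg hC (sq_nonneg (X N t - Y N t))]
    have hflux' := mul_le_mul_of_nonneg_left hflux
      (show 0 ≤ (1 / 2) ^ N * lam N ^ β by positivity)
    have h1 := mul_le_mul_of_nonneg_left (hEd X (hXpos (N + 1) (by omega) le_rfl) t ht) hc0
    have h2 := mul_le_mul_of_nonneg_left (hEd Y (hYpos (N + 1) (by omega) le_rfl) t ht) hc0
    have h3 : c * -(2 * ν * (lam N ^ 2 * X N t ^ 2)) + c * -(2 * ν * (lam N ^ 2 * Y N t ^ 2))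
        = -((1 / 2) ^ N * lam N ^ β * (C * (2 * (X N t ^ 2 + Y N t ^ 2)))) := by
      linear_combination (-(2 * (X N t ^ 2 + Y N t ^ 2))) * hcν
    linarith

/-- Existence of Galerkin approximations. -/
theorem exists_galerkin {β ν : ℝ} (hβ : β ≠ 0) (hν : 0 < ν) (x : ℕ → ℝ) (N : ℕ) {T : ℝ}
    (hT : 0 ≤ T) : ∃ X : ℕ → ℝ → ℝ, IsTruncatedSolution β ν N T X ∧
      (∀ n, 1 ≤ n → n ≤ N → X n 0 = x n) ∧ (∀ n t, n = 0 ∨ N < n → X n t = 0) := by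
  let e : EuclideanSpace ℝ (Fin N) → ℕ → ℝ := fun y n =>
    if h : 1 ≤ n ∧ n ≤ N then y ⟨n - 1, by omega⟩ else 0
  let v : EuclideanSpace ℝ (Fin N) → EuclideanSpace ℝ (Fin N) := fun y =>
    WithLp.toLp 2 fun i => dyadicField β ν (e y) (i + 1)
  have he : ∀ (y : EuclideanSpace ℝ (Fin N)) (i : Fin N), e y (i + 1) = y i := fun y i => by
    simp [e, i.2]
  have hzero : ∀ y n, n = 0 ∨ N < n → e y n = 0 := fun y n hn => by
    simp only [e]
    rw [dif_neg (by omega)]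
  have heC : ∀ n, ContDiff ℝ 1 fun y => e y n := by
    intro n
    by_cases h : 1 ≤ n ∧ n ≤ N
    · simp only [e, h, and_self, dite_true]
      fun_prop
    · simp only [e, h, dite_false]
      fun_prop
  have hv : ContDiff ℝ 1 v := by
    rw [contDiff_euclidean]
    intro i
    have h1 := heC (i + 1)
    have h2 := heC (i + 1 - 1)
    have h3 := heC (i + 1 + 1)
    simp only [v, dyadicField]
    fun_prop
  have hinner : ∀ y, inner ℝ y (v y) ≤ 0 := by
    intro y
    have h1 : inner ℝ y (v y) = ∑ n ∈ Finset.range N,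
        e y (n + 1) * dyadicField β ν (e y) (n + 1) := by
      rw [PiLp.inner_apply, ← Fin.sum_univ_eq_sum_range
        (fun n => e y (n + 1) * dyadicField β ν (e y) (n + 1))]
      refine Finset.sum_congr rfl fun i _ => ?_
      rw [he]
      simp [v, mul_comm]
    have h2 := sum_mul_dyadicField hβ ν (e y) N
    rw [hzero y (N + 1) (by omega)] at h2
    simp only [mul_assoc, ← Finset.mul_sum] at h2
    have h3 : 0 ≤ ν * ∑ n ∈ Finset.range N, lam (n + 1) ^ 2 * e y (n + 1) ^ 2 :=
      mul_nonneg hν.le (Finset.sum_nonneg fun _ _ => by positivity)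
    rw [h1]
    linarith
  obtain ⟨α, hα0, hα⟩ := exists_solution_of_inner_nonpos hv hinner
    (WithLp.toLp 2 fun i : Fin N => x (i + 1)) hT
  refine ⟨fun n t => e (α t) n, fun n hn hnN t ht => ?_, fun n hn hnN => ?_,
    fun n t hn => hzero _ n hn⟩
  · obtain ⟨n, rfl⟩ := Nat.exists_eq_add_of_le' hn
    have hproj : (fun t => e (α t) (n + 1)) =
        fun t => EuclideanSpace.proj (𝕜 := ℝ) (⟨n, by omega⟩ : Fin N) (α t) := by
      ext t
      exact he (α t) ⟨n, by omega⟩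
    change HasDerivWithinAt (fun t => e (α t) (n + 1)) _ _ _
    rw [hproj]
    exact (EuclideanSpace.proj (𝕜 := ℝ) (⟨n, by omega⟩ : Fin N)).hasFDerivAt.comp_hasDerivWithinAt
      t (hα t ht)
  · obtain ⟨n, rfl⟩ := Nat.exists_eq_add_of_le' hn
    have := he (α 0) ⟨n, by omega⟩
    simp only at this ⊢
    rw [this, hα0]

/-- A pointwise limit of functions with uniformly bounded derivatives is continuous. -/
theorem continuousOn_of_tendsto_of_deriv_bound {F F' : ℕ → ℝ → ℝ} {f : ℝ → ℝ} {K : ℝ}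
    (hF : ∀ T, ∀ᶠ N in atTop, ∀ t ∈ Set.Icc 0 T,
      HasDerivWithinAt (F N) (F' N t) (Set.Icc 0 T) t)
    (hK : ∀ T, ∀ᶠ N in atTop, ∀ t ∈ Set.Icc 0 T, |F' N t| ≤ K)
    (hf : ∀ t, 0 ≤ t → Tendsto (fun N => F N t) atTop (𝓝 (f t))) :
    ContinuousOn f (Set.Ici 0) := by
  have hK0 : 0 ≤ K := by
    obtain ⟨N, hN⟩ := (hK 0).exists
    exact (abs_nonneg _).trans (hN 0 (by simp))
  refine (LipschitzOnWith.of_dist_le_mul (K := K.toNNReal) fun a ha b hb => ?_).continuousOn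
  rw [Real.coe_toNNReal K hK0]
  refine le_of_tendsto ((hf a ha).dist (hf b hb)) ?_
  filter_upwards [hF (max a b), hK (max a b)] with N h1 h2
  have := (convex_Icc 0 (max a b)).norm_image_sub_le_of_norm_hasDerivWithin_le h1
    (fun t ht => h2 t ht) (x := b) (y := a) ⟨hb, le_max_right _ _⟩ ⟨ha, le_max_left _ _⟩
  simpa [dist_eq_norm] using this

/-- Passing to the limit in a differential equation, given bounded convergence of the
right-hand side. -/
theorem hasDerivWithinAt_Ici_of_tendsto {F F' : ℕ → ℝ → ℝ} {f g : ℝ → ℝ} {K : ℝ}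
    (hF : ∀ T, ∀ᶠ N in atTop, ∀ t ∈ Set.Icc 0 T,
      HasDerivWithinAt (F N) (F' N t) (Set.Icc 0 T) t)
    (hF' : ∀ T, ∀ᶠ N in atTop, ContinuousOn (F' N) (Set.Icc 0 T))
    (hK : ∀ T, ∀ᶠ N in atTop, ∀ t ∈ Set.Icc 0 T, |F' N t| ≤ K)
    (hf : ∀ t, 0 ≤ t → Tendsto (fun N => F N t) atTop (𝓝 (f t)))
    (hg : ∀ t, 0 ≤ t → Tendsto (fun N => F' N t) atTop (𝓝 (g t)))
    (hgc : ContinuousOn g (Set.Ici 0)) {t : ℝ} (ht : 0 ≤ t) :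
    HasDerivWithinAt f (g t) (Set.Ici 0) t := by
  have hgc' : Continuous fun s => g (max s 0) :=
    hgc.comp_continuous (by fun_prop) fun s => Set.mem_Ici.2 (le_max_right _ _)
  have hftc : ∀ s, 0 ≤ s → f s = f 0 + ∫ u in (0)..s, g (max u 0) := by
    intro s hs
    have h1 : Tendsto (fun N => ∫ u in (0)..s, F' N u) atTop
        (𝓝 (∫ u in (0)..s, g (max u 0))) := by
      refine intervalIntegral.tendsto_integral_filter_of_dominated_convergence (fun _ => K)
        ?_ ?_ (by simp) ?_
      · filter_upwards [hF' s] with N hN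
        rw [Set.uIoc_of_le hs]
        exact (hN.mono Set.Ioc_subset_Icc_self).aestronglyMeasurable measurableSet_Ioc
      · filter_upwards [hK s] with N hN
        refine Eventually.of_forall fun u hu => ?_
        rw [Set.uIoc_of_le hs] at hu
        exact hN u ⟨hu.1.le, hu.2⟩
      · refine Eventually.of_forall fun u hu => ?_
        rw [Set.uIoc_of_le hs] at hu
        rw [max_eq_left hu.1.le]
        exact hg u hu.1.le
    have h2 : Tendsto (fun N => F N s - F N 0) atTop (𝓝 (∫ u in (0)..s, g (max u 0))) := by
      refine h1.congr' ?_
      filter_upwards [hF s, hF' s] with N hN hN'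
      refine intervalIntegral.integral_eq_sub_of_hasDerivAt_of_le hs
        (fun u hu => (hN u hu).continuousWithinAt)
        (fun u hu => (hN u ⟨hu.1.le, hu.2.le⟩).hasDerivAt (Icc_mem_nhds hu.1 hu.2)) ?_
      exact ContinuousOn.intervalIntegrable (by rwa [Set.uIcc_of_le hs])
    linarith [tendsto_nhds_unique h2 ((hf s hs).sub (hf 0 le_rfl))]
  have hd : HasDerivAt (fun s => f 0 + ∫ u in (0)..s, g (max u 0)) (g (max t 0)) t :=
    (hgc'.integral_hasStrictDerivAt 0 t).hasDerivAt.const_add _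
  rw [max_eq_left ht] at hd
  exact hd.hasDerivWithinAt.congr (fun s hs => hftc s hs) (hftc t ht)

theorem IsTruncatedSolution.mono {β ν T T' : ℝ} {N M : ℕ} {X : ℕ → ℝ → ℝ}
    (hX : IsTruncatedSolution β ν M T' X) (hNM : N ≤ M) (hT : T ≤ T') :
    IsTruncatedSolution β ν N T X := fun n hn hnN t ht =>
  (hX n hn (hnN.trans hNM) t ⟨ht.1, ht.2.trans hT⟩).mono (Set.Icc_subset_Icc_right hT)

theorem tendsto_truncation_error {β : ℝ} (hβ : β < 3) :
    Tendsto (fun N : ℕ => (1 / 2) ^ N * lam N ^ β / lam N ^ 2) atTop (𝓝 0) := by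
  have h1 : Tendsto (fun N : ℕ => ((2 : ℝ) ^ (β - 3)) ^ N) atTop (𝓝 0) :=
    tendsto_pow_atTop_nhds_zero_of_lt_one (by positivity)
      (Real.rpow_lt_one_of_one_lt_of_neg one_lt_two (by linarith))
  refine h1.congr' ?_
  filter_upwards [eventually_ge_atTop 1] with N hN
  rw [lam_of_pos hN, ← Real.rpow_natCast_mul zero_le_two, mul_comm (N : ℝ),
    Real.rpow_mul_natCast zero_le_two, Real.rpow_sub two_pos]
  have : (2 : ℝ) ^ (3 : ℝ) = 2 * 2 ^ 2 := by norm_num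
  rw [this, div_pow, mul_pow, ← pow_mul, ← pow_mul, mul_comm 2 N, one_div, inv_pow]
  field_simp

theorem sq_sub_le_of_sum_le {n N : ℕ} (hn : 1 ≤ n) (hnN : n ≤ N) {x y : ℕ → ℝ} {B : ℝ}
    (h : ∑ n ∈ Finset.range N, (1 / 2) ^ (n + 1) * (x (n + 1) - y (n + 1)) ^ 2 ≤ B) :
    (x n - y n) ^ 2 ≤ 2 ^ n * B := by
  obtain ⟨n, rfl⟩ := Nat.exists_eq_add_of_le' hn
  have h1 := (Finset.single_le_sum
    (f := fun n => (1 / 2 : ℝ) ^ (n + 1) * (x (n + 1) - y (n + 1)) ^ 2)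
    (fun _ _ => by positivity) (Finset.mem_range.2 hnN)).trans h
  simp only [one_div, inv_pow] at h1
  have h2 := mul_le_mul_of_nonneg_left h1 (by positivity : (0 : ℝ) ≤ 2 ^ (n + 1))
  rwa [mul_inv_cancel_left₀ (by positivity)] at h2

theorem le_of_sum_sq_le {n N : ℕ} (hn : 1 ≤ n) (hnN : n ≤ N) {x : ℕ → ℝ} {S : ℝ}
    (h : ∑ n ∈ Finset.range N, x (n + 1) ^ 2 ≤ S) : x n ≤ S + 1 := by
  obtain ⟨n, rfl⟩ := Nat.exists_eq_add_of_le' hn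
  have h1 := (Finset.single_le_sum (f := fun n => x (n + 1) ^ 2)
    (fun _ _ => by positivity) (Finset.mem_range.2 hnN)).trans h
  nlinarith [sq_nonneg (x (n + 1) - 1)]

/-- Existence of a weak solution which is a limit of Galerkin approximations. -/
theorem exists_solution {β ν : ℝ} (hβ0 : 0 < β) (hβ3 : β < 3) (hν : 0 < ν) {x : ℕ → ℝ}
    (hxpos : ∀ n, 1 ≤ n → 0 ≤ x n) (hxH : Summable fun n => x (n + 1) ^ 2) :
    ∃ (X : ℕ → ℝ → ℝ) (G : ℕ → ℕ → ℝ → ℝ), IsViscousSolution β ν (Set.Ici 0) X ∧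
      (∀ n, 1 ≤ n → X n 0 = x n) ∧ (∀ N, IsTruncatedSolution β ν N N (G N)) ∧
      (∀ N n, 1 ≤ n → n ≤ N → G N n 0 = x n) ∧ (∀ N n t, n = 0 ∨ N < n → G N n t = 0) ∧
      (∀ (N n : ℕ), ∀ t ∈ Set.Icc (0 : ℝ) N, 0 ≤ G N n t) ∧
      (∀ n t, 0 ≤ t → Tendsto (fun N => G N n t) atTop (𝓝 (X n t))) := by
  choose G hG hG0 hGz using fun N : ℕ =>
    exists_galerkin hβ0.ne' hν x N (T := N) (Nat.cast_nonneg N)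
  set S := ∑' n, x (n + 1) ^ 2
  have hS : 0 ≤ S := tsum_nonneg fun _ => by positivity
  have hpos : ∀ (N n : ℕ), ∀ t ∈ Set.Icc (0 : ℝ) N, 0 ≤ G N n t := by
    intro N n t ht
    by_cases h : n = 0 ∨ N < n
    · rw [hGz N n t h]
    push Not at h
    refine (hG N).nonneg (by omega) h.2 ?_ ?_ t ht
    · by_cases h' : N < n + 1
      · exact (continuousOn_const (c := (0 : ℝ))).congr fun t _ => hGz N (n + 1) t (Or.inr h')
      · exact (hG N).continuousOn (by omega) (by omega)
    · rw [hG0 N n (by omega) h.2]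
      exact hxpos n (by omega)
  have hS0 : ∀ N, ∑ n ∈ Finset.range N, G N (n + 1) 0 ^ 2 ≤ S := by
    intro N
    rw [Finset.sum_congr rfl fun n hn =>
      by rw [hG0 N (n + 1) (by omega) (by have := Finset.mem_range.1 hn; omega)]]
    exact hxH.sum_le_tsum _ fun _ _ => by positivity
  have hC : ∀ (N n : ℕ), ∀ t ∈ Set.Icc (0 : ℝ) N, G N n t ≤ S + 1 := by
    intro N n t ht
    by_cases h : n = 0 ∨ N < n
    · rw [hGz N n t h]
      linarith
    push Not at h
    exact le_of_sum_sq_le (x := fun k => G N k t) (by omega) h.2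
      (((hG N).energy_le hβ0.ne' hν (fun t ht => hpos N _ t ht) ht).trans (hS0 N))
  have hdiff : ∀ n : ℕ, 1 ≤ n → ∀ N M : ℕ, n ≤ N → N ≤ M → ∀ t ∈ Set.Icc (0 : ℝ) N,
      (G N n t - G M n t) ^ 2 ≤ 2 ^ n * ((S + 1) / ν *
        ((1 / 2) ^ N * lam N ^ β / lam N ^ 2) * (2 * S)) := by
    intro n hn N M hnN hNM t ht
    have hNM' : (N : ℝ) ≤ M := by exact_mod_cast hNM
    have hsub : ∀ {t}, t ∈ Set.Icc (0 : ℝ) N → t ∈ Set.Icc (0 : ℝ) M :=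
      fun ht => ⟨ht.1, ht.2.trans hNM'⟩
    refine sq_sub_le_of_sum_le (x := fun k => G N k t) (y := fun k => G M k t) hn hnN ?_
    refine ((hG N).weighted_sub_le hβ0.ne' hν (hn.trans hnN) ((hG M).mono hNM hNM')
      (fun n _ _ => hpos N n) (fun n _ _ t ht => hpos M n t (hsub ht)) (hC N _)
      (fun t ht => hC M _ t (hsub ht)) (fun n hn hnN => ?_) ht).trans ?_
    · rw [hG0 N n hn hnN, hG0 M n hn (hnN.trans hNM)]
    · have := Real.rpow_nonneg (lam_nonneg N) β
      have := hS0 N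
      gcongr
  have hcauchy : ∀ n t, 0 ≤ t → ∃ y, Tendsto (fun N => G N n t) atTop (𝓝 y) := by
    intro n t ht
    rcases Nat.eq_zero_or_pos n with rfl | hn
    · exact ⟨0, by simp [hGz]⟩
    refine cauchySeq_tendsto_of_complete (Metric.cauchySeq_iff'.2 fun ε hε => ?_)
    have h1 : Tendsto (fun N : ℕ => (2 : ℝ) ^ n * ((S + 1) / ν *
        ((1 / 2) ^ N * lam N ^ β / lam N ^ 2) * (2 * S))) atTop (𝓝 0) := by
      simpa using (((tendsto_truncation_error hβ3).const_mul ((S + 1) / ν)).mul_const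
        (2 * S)).const_mul ((2 : ℝ) ^ n)
    obtain ⟨N, hNε, hnN, htN⟩ := ((h1.eventually_lt_const (by positivity : 0 < ε ^ 2)).and
      ((eventually_ge_atTop n).and (eventually_ge_atTop ⌈t⌉₊))).exists
    refine ⟨N, fun M hM => ?_⟩
    rw [dist_comm, Real.dist_eq]
    exact abs_lt_of_sq_lt_sq ((hdiff n hn N M hnN hM t
      ⟨ht, (Nat.le_ceil t).trans (by exact_mod_cast htN)⟩).trans_lt hNε) hε.le
  choose X hX using hcauchy
  let Y : ℕ → ℝ → ℝ := fun n t => if h : 0 ≤ t then X n t h else 0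
  have hY : ∀ n t, 0 ≤ t → Tendsto (fun N => G N n t) atTop (𝓝 (Y n t)) := fun n t ht => by
    simp only [Y, ht, dite_true]
    exact hX n t ht
  have hev : ∀ (T : ℝ) (n : ℕ), ∀ᶠ N : ℕ in atTop, T ≤ N ∧ n + 1 ≤ N := fun T n =>
    (tendsto_natCast_atTop_atTop.eventually_ge_atTop T).and (eventually_ge_atTop (n + 1))
  have hF : ∀ n, 1 ≤ n → ∀ T, ∀ᶠ N in atTop, ∀ t ∈ Set.Icc 0 T, HasDerivWithinAt (G N n)
      (dyadicField β ν (fun k => G N k t) n) (Set.Icc 0 T) t := fun n hn T => by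
    filter_upwards [hev T n] with N hN
    exact (hG N).mono le_rfl hN.1 n hn (by omega)
  have hK : ∀ n, ∀ T, ∀ᶠ N in atTop, ∀ t ∈ Set.Icc 0 T,
      |dyadicField β ν (fun k => G N k t) n| ≤ ν * lam n ^ 2 * (S + 1) +
        lam (n - 1) ^ β * (S + 1) ^ 2 + lam n ^ β * (S + 1) * (S + 1) := fun n T => by
    filter_upwards [hev T n] with N hN t ht
    have ht' : t ∈ Set.Icc (0 : ℝ) N := ⟨ht.1, ht.2.trans hN.1⟩
    have hb : ∀ k, |G N k t| ≤ S + 1 := fun k => by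
      rw [abs_of_nonneg (hpos N k t ht')]
      exact hC N k t ht'
    have h1 := Real.rpow_nonneg (lam_nonneg n) β
    have h2 := Real.rpow_nonneg (lam_nonneg (n - 1)) β
    simp only [dyadicField]
    refine (abs_sub _ _).trans (add_le_add ((abs_add_le _ _).trans (add_le_add ?_ ?_)) ?_)
    · rw [abs_mul, abs_mul, abs_neg, abs_of_pos hν, abs_of_nonneg (sq_nonneg _)]
      have := hb n
      gcongr
    · rw [abs_mul, abs_pow, abs_of_nonneg h2]
      have := hb (n - 1)
      gcongr
    · rw [abs_mul, abs_mul, abs_of_nonneg h1]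
      have := hb n
      have := hb (n + 1)
      gcongr
  have hYc : ∀ n, ContinuousOn (Y n) (Set.Ici 0) := fun n => by
    rcases Nat.eq_zero_or_pos n with rfl | hn
    · refine (continuousOn_const (c := (0 : ℝ))).congr fun t ht => ?_
      exact tendsto_nhds_unique (hY 0 t ht) (by simp [hGz])
    · exact continuousOn_of_tendsto_of_deriv_bound (hF n hn) (hK n) (hY n)
  refine ⟨Y, G, fun n hn t ht => ?_, fun n hn => ?_, hG, hG0, hGz, hpos, hY⟩
  · refine hasDerivWithinAt_Ici_of_tendsto
      (g := fun t => dyadicField β ν (fun k => Y k t) n) (hF n hn) (fun T => ?_) (hK n) (hY n)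
      (fun t ht => ?_) ?_ ht
    · filter_upwards [hev T n] with N hN
      have hc : ∀ k, k ≤ N → ContinuousOn (G N k) (Set.Icc 0 T) := fun k hk => by
        rcases Nat.eq_zero_or_pos k with rfl | hk0
        · exact (continuousOn_const (c := (0 : ℝ))).congr fun t _ => hGz N 0 t (Or.inl rfl)
        · exact ((hG N).mono le_rfl hN.1).continuousOn hk0 hk
      have := hc n (by omega)
      have := hc (n - 1) (by omega)
      have := hc (n + 1) (by omega)
      simp only [dyadicField]
      fun_prop
    · exact ((((hY n t ht).const_mul _).add (((hY (n - 1) t ht).pow 2).const_mul _))).sub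
        (((hY n t ht).const_mul _).mul (hY (n + 1) t ht))
    · have := hYc n
      have := hYc (n - 1)
      have := hYc (n + 1)
      simp only [dyadicField]
      fun_prop
  · refine tendsto_nhds_unique (hY n 0 le_rfl) (tendsto_const_nhds.congr' ?_)
    filter_upwards [eventually_ge_atTop n] with N hN
    exact (hG0 N n hn hN).symm

theorem IsViscousSolution.energy_le {β ν : ℝ} (hβ : β ≠ 0) (hν : 0 < ν) {X : ℕ → ℝ → ℝ}
    (hX : IsViscousSolution β ν (Set.Ici 0) X) (h0 : ∀ n, 1 ≤ n → 0 ≤ X n 0)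
    (hH : Summable fun n => X (n + 1) 0 ^ 2) {t : ℝ} (ht : 0 ≤ t) (N : ℕ) :
    ∑ n ∈ Finset.range N, X (n + 1) t ^ 2 ≤ ∑' n, X (n + 1) 0 ^ 2 :=
  ((hX.isTruncatedSolution N t).energy_le hβ hν
    (fun _ hs => hX.nonneg h0 (Nat.le_add_left 1 N) hs.1) ⟨ht, le_rfl⟩).trans
      (hH.sum_le_tsum _ fun _ _ => by positivity)

theorem IsViscousSolution.summable_sq {β ν : ℝ} (hβ : β ≠ 0) (hν : 0 < ν) {X : ℕ → ℝ → ℝ}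
    (hX : IsViscousSolution β ν (Set.Ici 0) X) (h0 : ∀ n, 1 ≤ n → 0 ≤ X n 0)
    (hH : Summable fun n => X (n + 1) 0 ^ 2) {t : ℝ} (ht : 0 ≤ t) :
    Summable fun n => X (n + 1) t ^ 2 :=
  summable_of_sum_range_le (fun _ => by positivity) (hX.energy_le hβ hν h0 hH ht)

/-- Uniqueness of weak solutions with nonnegative square-summable initial condition. -/
theorem IsViscousSolution.eq {β ν : ℝ} (hβ0 : 0 < β) (hβ3 : β < 3) (hν : 0 < ν)
    {X Y : ℕ → ℝ → ℝ} (hX : IsViscousSolution β ν (Set.Ici 0) X)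
    (hY : IsViscousSolution β ν (Set.Ici 0) Y) (hXY : ∀ n, 1 ≤ n → X n 0 = Y n 0)
    (h0 : ∀ n, 1 ≤ n → 0 ≤ X n 0) (hH : Summable fun n => X (n + 1) 0 ^ 2) {n : ℕ}
    (hn : 1 ≤ n) {t : ℝ} (ht : 0 ≤ t) : X n t = Y n t := by
  have h0' : ∀ n, 1 ≤ n → 0 ≤ Y n 0 := fun n hn => hXY n hn ▸ h0 n hn
  have hXY' : (fun n => Y (n + 1) 0 ^ 2) = fun n => X (n + 1) 0 ^ 2 :=
    funext fun n => by rw [hXY (n + 1) (by omega)]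
  have hH' : Summable fun n => Y (n + 1) 0 ^ 2 := hXY' ▸ hH
  set S := ∑' n, X (n + 1) 0 ^ 2 with hS
  have hS' : S = ∑' n, Y (n + 1) 0 ^ 2 := by rw [hS, hXY']
  have hS0 : 0 ≤ S := tsum_nonneg fun _ => by positivity
  have hle : ∀ᶠ N in atTop, (X n t - Y n t) ^ 2 ≤ 2 ^ n * ((S + 1) / ν *
      ((1 / 2) ^ N * lam N ^ β / lam N ^ 2) * (2 * S)) := by
    filter_upwards [eventually_ge_atTop n] with N hN
    refine sq_sub_le_of_sum_le (x := fun k => X k t) (y := fun k => Y k t) hn hN ?_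
    refine ((hX.isTruncatedSolution N t).weighted_sub_le (C := S + 1) hβ0.ne' hν
      (hn.trans hN) (hY.isTruncatedSolution N t) (fun n hn _ s hs => hX.nonneg h0 hn hs.1)
      (fun n hn _ s hs => hY.nonneg h0' hn hs.1) (fun s hs => ?_) (fun s hs => ?_)
      (fun n hn _ => hXY n hn) ⟨ht, le_rfl⟩).trans ?_
    · exact le_of_sum_sq_le (x := fun k => X k s) (by omega) le_rfl
        (hX.energy_le hβ0.ne' hν h0 hH hs.1 (N + 1))
    · rw [hS']
      exact le_of_sum_sq_le (x := fun k => Y k s) (by omega) le_rfl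
        (hY.energy_le hβ0.ne' hν h0' hH' hs.1 (N + 1))
    · have := Real.rpow_nonneg (lam_nonneg N) β
      have := hX.energy_le hβ0.ne' hν h0 hH le_rfl N
      gcongr
  have hlim : Tendsto (fun N : ℕ => (2 : ℝ) ^ n * ((S + 1) / ν *
      ((1 / 2) ^ N * lam N ^ β / lam N ^ 2) * (2 * S))) atTop (𝓝 0) := by
    simpa using (((tendsto_truncation_error hβ3).const_mul ((S + 1) / ν)).mul_const
      (2 * S)).const_mul ((2 : ℝ) ^ n)
  exact sub_eq_zero.1 (pow_eq_zero_iff two_ne_zero |>.1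
    (le_antisymm (ge_of_tendsto hlim hle) (sq_nonneg _)))

theorem two_rpow_thousandth_le : (2 : ℝ) ^ (1 / 1000 : ℝ) ≤ 1.001 := by
  have h1 : (2 : ℝ) ≤ 1.001 ^ 1000 := by
    have := one_add_mul_le_pow (a := (0.001 : ℝ)) (by norm_num) 1000
    norm_num at this ⊢
    exact this
  have h2 := Real.rpow_le_rpow zero_le_two h1 (by norm_num : (0 : ℝ) ≤ ((1000 : ℕ) : ℝ)⁻¹)
  rw [Real.pow_rpow_inv_natCast (by norm_num) (by norm_num)] at h2
  norm_num at h2 ⊢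
  exact h2

theorem lam_rpow {n : ℕ} (hn : 1 ≤ n) (s : ℝ) : lam n ^ s = (2 ^ s) ^ n := by
  rw [lam_of_pos hn, ← Real.rpow_natCast_mul zero_le_two, mul_comm,
    Real.rpow_mul_natCast zero_le_two]

/-- A bound on `lam n * x n` for the initial condition propagates, in a weaker form, to all
later times. -/
theorem IsViscousSolution.exists_bound_of_lam_mul_le {β ν C : ℝ} (hβ1 : 2 < β)
    (hβ2 : β ≤ 5 / 2) (hν : 0 < ν) {X : ℕ → ℝ → ℝ} (hX : IsViscousSolution β ν (Set.Ici 0) X)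
    (h0 : ∀ n, 1 ≤ n → 0 ≤ X n 0) (hH : Summable fun n => X (n + 1) 0 ^ 2)
    (hC : ∀ n, 1 ≤ n → lam n * X n 0 ≤ C) :
    ∃ M : ℝ, ∀ n, 1 ≤ n → ∀ t, 0 ≤ t → lam n ^ (β - 2 + 1 / 1000) * X n t ≤ M := by
  obtain ⟨X', G, hX', hX'0, hG, hG0, hGz, hpos, hlim⟩ :=
    exists_solution (by linarith : 0 < β) (by linarith) hν h0 hH
  have hC0 : 0 ≤ C := (mul_nonneg (lam_nonneg 1) (h0 1 le_rfl)).trans (hC 1 le_rfl)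
  set q : ℝ := 2 ^ (1 / 1000 : ℝ) with hq
  set b : ℝ := 2 ^ β with hb
  have hq1 : 1 < q := Real.one_lt_rpow one_lt_two (by norm_num)
  have hq2 : q ≤ 1.001 := two_rpow_thousandth_le
  have hb1 : 4 < b := by
    have : (2 : ℝ) ^ (2 : ℝ) < 2 ^ β := Real.rpow_lt_rpow_of_exponent_lt one_lt_two hβ1
    norm_num at this
    exact this
  have hb2 : b ^ 2 ≤ 32 := by
    have : (2 : ℝ) ^ (β * (2 : ℕ)) ≤ 2 ^ (5 : ℝ) :=
      Real.rpow_le_rpow_of_exponent_le one_le_two (by push_cast; linarith)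
    rw [Real.rpow_mul_natCast zero_le_two] at this
    norm_num at this
    exact this
  set p : ℝ := b * q / 4 with hp
  have hps : (2 : ℝ) ^ (β - 2 + 1 / 1000) = p := by
    rw [Real.rpow_add two_pos, Real.rpow_sub two_pos, hp, hb, hq]
    norm_num
    ring
  have hp1 : 1 ≤ p := by rw [hp]; nlinarith
  have hp2 : p ≤ 2 := by rw [hp]; nlinarith
  have hp0 : 0 < p := by linarith
  have hb0 : 0 < b := by linarith
  have hbp : b * q = 4 * p := by rw [hp]; ring
  set M : ℝ := 1 + 5 / 2 * C + C ^ 2 / ν with hM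
  have hM0 : 0 < M := by positivity
  have hM1 : 5 / 2 * C ≤ M := by
    have : 0 ≤ C ^ 2 / ν := by positivity
    linarith
  have hM2 : C ^ 2 ≤ ν * M := by
    have : C ^ 2 / ν ≤ M := by linarith
    rw [div_le_iff₀ hν] at this
    linarith
  set d : ℝ := p ^ 3 / b with hd
  have hd' : d = b ^ 2 * q ^ 3 / 64 := by
    rw [hd, hp]
    field_simp
    norm_num
  have hq3 : q ^ 3 ≤ 1.001 ^ 3 := pow_le_pow_left₀ (by linarith) hq2 3
  have hq3' : 1 ≤ q ^ 3 := one_le_pow₀ hq1.le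
  have hd1 : 1 / 4 ≤ d := by rw [hd']; nlinarith
  have hd2 : d ≤ 0.502 := by rw [hd']; nlinarith
  have hκN : ∀ᶠ N : ℕ in atTop, 1.001 * d ≤ ν * p / M * q ^ (N + 1) :=
    (((tendsto_pow_atTop_atTop_of_one_lt hq1).comp (tendsto_add_atTop_nat 1)).const_mul_atTop
      (by positivity : 0 < ν * p / M)).eventually_ge_atTop _
  refine ⟨M, fun n hn t ht => ?_⟩
  rw [hX.eq (by linarith) (by linarith) hν hX' (fun n hn => (hX'0 n hn).symm) h0 hH hn ht,
    lam_rpow hn, hps]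
  refine le_of_tendsto (((hlim n t ht).comp (tendsto_add_atTop_nat 1)).const_mul _) ?_
  filter_upwards [hκN, eventually_ge_atTop n, eventually_ge_atTop ⌈t⌉₊] with N hN hnN htN
  have htN' : t ≤ (N + 1 : ℕ) := (Nat.le_ceil t).trans (by exact_mod_cast (by omega))
  have hY0 : ∀ k, 1 ≤ k → k ≤ N + 1 → p ^ k * G (N + 1) k 0 ≤ C := fun k hk hkN => by
    rw [hG0 (N + 1) k hk hkN]
    refine le_trans ?_ (hC k hk)
    rw [lam_of_pos hk]
    have := h0 k hk
    gcongr
  have key := rescaled_modes_le_one (N := N) (T := (N + 1 : ℕ)) (R := b / p) (q := q) (d := d)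
    (r := fun k => M / p * (b / p) ^ k) (κ := fun k => ν * p / M * q ^ k)
    (Y := fun k t => p ^ k * G (N + 1) k t / M) ?_ ?_ hq1.le hq2 hd1 hd2
    (fun k _ => by positivity) (fun k _ => by ring) (fun k _ => by positivity)
    (fun k _ => by ring) (fun t => by rw [hGz _ _ _ (Or.inl rfl)]; simp)
    (fun t => by rw [hGz _ _ _ (Or.inr (by omega))]; simp) (fun k t ht => ?_)
    (fun k hk hkN t ht => ?_) hN (fun k hk hkN => ?_) (fun k hk hkN => ?_)
    n hn (by omega) t ⟨ht, htN'⟩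
  · rwa [div_le_one hM0] at key
  · rw [le_div_iff₀ hp0]
    nlinarith
  · rw [div_le_iff₀ hp0]
    nlinarith
  · have := hpos (N + 1) k t ht
    positivity
  · refine (((hG (N + 1) k hk hkN t ht).const_mul (p ^ k)).div_const M).congr_deriv ?_
    obtain ⟨m, rfl⟩ := Nat.exists_eq_add_of_le' hk
    simp only [dyadicField, Nat.add_sub_cancel]
    have h4 : lam (m + 1) ^ 2 = 4 * (b * q / p) ^ m := by
      rw [lam_of_pos hk, hbp, mul_div_cancel_right₀ _ hp0.ne', ← pow_mul, mul_comm, pow_mul,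
        pow_succ]
      norm_num
      ring
    have hflux : lam m ^ β * G (N + 1) m t ^ 2 = b ^ m * G (N + 1) m t ^ 2 := by
      rcases Nat.eq_zero_or_pos m with rfl | hm
      · rw [hGz _ _ _ (Or.inl rfl)]
        simp
      · rw [lam_rpow hm]
    have h4' : (4 : ℝ) = b * q / p := by rw [hbp]; field_simp
    rw [hflux, h4, lam_rpow hk, ← hb, h4']
    rw [hd]
    simp only [div_pow, mul_pow]
    field_simp
    ring
  · rw [div_le_iff₀ hM0]
    linarith [hY0 k hk hkN]
  · have h1 := hY0 k hk hkN
    have h2 : 0 ≤ p ^ k * G (N + 1) k 0 := by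
      rw [hG0 (N + 1) k hk hkN]
      have := h0 k hk
      positivity
    have h3 : (p ^ k * G (N + 1) k 0) ^ 2 ≤ ν * M := (pow_le_pow_left₀ h2 h1 2).trans hM2
    have h4 : 1 ≤ p * q ^ k := one_le_mul_of_one_le_of_one_le hp1 (one_le_pow₀ hq1.le)
    rw [div_pow, mul_div_assoc', div_le_iff₀ (by positivity)]
    have h5 : ν * p / M * q ^ k * M ^ 2 = ν * M * (p * q ^ k) := by
      field_simp
    rw [h5]
    calc 1.001 * d * (p ^ k * G (N + 1) k 0) ^ 2 ≤ 1 * (ν * M) := by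
          gcongr
          linarith
      _ ≤ ν * M * (p * q ^ k) := by
          rw [one_mul]
          exact le_mul_of_one_le_right (by positivity) h4

/-- Within any positive time, the solution visits the space of bounded `lam n * X n`. -/
theorem IsViscousSolution.exists_lam_mul_le {β ν τ : ℝ} (hβ : β ≠ 0) (hν : 0 < ν) (hτ : 0 < τ)
    {X : ℕ → ℝ → ℝ} (hX : IsViscousSolution β ν (Set.Ici 0) X) (h0 : ∀ n, 1 ≤ n → 0 ≤ X n 0)
    (hH : Summable fun n => X (n + 1) 0 ^ 2) :
    ∃ t ∈ Set.Icc 0 τ, ∃ C : ℝ, ∀ n, 1 ≤ n → lam n * X n t ≤ C := by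
  set S := ∑' n, X (n + 1) 0 ^ 2
  set C := (S + 1) / (2 * ν * τ) with hC
  let D : ℕ → ℝ → ℝ := fun N t => ∑ n ∈ Finset.range N, lam (n + 1) ^ 2 * X (n + 1) t ^ 2
  have hXc : ∀ n, 1 ≤ n → ContinuousOn (X n) (Set.Icc 0 τ) := fun n hn =>
    (hX.isTruncatedSolution n τ).continuousOn hn le_rfl
  have hDc : ∀ N, ContinuousOn (D N) (Set.Icc 0 τ) := fun N =>
    continuousOn_finsetSum _ fun n _ => ((hXc (n + 1) (by omega)).pow 2).const_mul _
  have hclosed : ∀ N, IsClosed {t ∈ Set.Icc 0 τ | D N t ≤ C} := fun N =>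
    isClosed_Icc.isClosed_le (hDc N) continuousOn_const
  have hne : ∀ N, {t ∈ Set.Icc 0 τ | D N t ≤ C}.Nonempty := by
    intro N
    by_contra hempty
    have hlt : ∀ t ∈ Set.Icc 0 τ, C < D N t := fun t ht => by
      by_contra h
      exact hempty ⟨t, ht, not_lt.1 h⟩
    have h1 := le_initial_of_deriv_nonpos (t₀ := 0) (T := τ)
      (f := fun t => ∑ n ∈ Finset.range N, X (n + 1) t ^ 2 + 2 * ν * C * t)
      (fun t ht => ((hX.isTruncatedSolution N τ).hasDerivWithinAt_energy hβ ht).add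
        ((hasDerivWithinAt_id t _).const_mul (2 * ν * C))) (fun t ht => ?_) τ
        ⟨hτ.le, le_rfl⟩
    · have h2 : 2 * ν * C * τ = S + 1 := by
        rw [hC]
        field_simp
      have h3 := hX.energy_le hβ hν h0 hH le_rfl N
      have h4 : 0 ≤ ∑ n ∈ Finset.range N, X (n + 1) τ ^ 2 :=
        Finset.sum_nonneg fun _ _ => by positivity
      linarith
    · have h2 := hX.nonneg h0 (Nat.le_add_left 1 N) ht.1
      have h3 := Real.rpow_nonneg (lam_nonneg N) β
      have h4 : 0 ≤ 2 * lam N ^ β * X N t ^ 2 * X (N + 1) t := by positivity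
      have h5 : 2 * ν * C ≤ 2 * ν * D N t := by
        have := hlt t ht
        gcongr
      simp only [D] at h5
      linarith
  have hD : ∀ N t, D N t ≤ D (N + 1) t := fun N t => by
    simp only [D, Finset.sum_range_succ _ N]
    exact le_add_of_nonneg_right (by positivity)
  obtain ⟨t, ht⟩ := IsCompact.nonempty_iInter_of_sequence_nonempty_isCompact_isClosed
    (fun N => {t ∈ Set.Icc 0 τ | D N t ≤ C}) (fun N t ht => ⟨ht.1, (hD N t).trans ht.2⟩) hne
    (isCompact_Icc.of_isClosed_subset (hclosed 0) fun t ht => ht.1) hclosed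
  rw [Set.mem_iInter] at ht
  refine ⟨t, (ht 0).1, C + 1, fun n hn => ?_⟩
  refine le_of_sum_sq_le (x := fun k => lam k * X k t) hn le_rfl ?_
  simpa only [mul_pow] using (ht n).2

theorem IsViscousSolution.shift {β ν s : ℝ} (hs : 0 ≤ s) {X : ℕ → ℝ → ℝ}
    (hX : IsViscousSolution β ν (Set.Ici 0) X) :
    IsViscousSolution β ν (Set.Ici 0) fun n t => X n (s + t) := fun n hn t ht => by
  have h : HasDerivWithinAt (fun t => X n (s + t)) _ (Set.Ici 0) t :=
    (hX n hn (s + t) (add_nonneg hs ht)).comp t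
      ((hasDerivWithinAt_id t (Set.Ici 0)).const_add s) fun u hu => add_nonneg hs hu
  exact h.congr_deriv (mul_one _)

theorem IsViscousSolution.exists_bound_after {β ν τ : ℝ} (hβ1 : 2 < β) (hβ2 : β ≤ 5 / 2)
    (hν : 0 < ν) (hτ : 0 < τ) {X : ℕ → ℝ → ℝ} (hX : IsViscousSolution β ν (Set.Ici 0) X)
    (h0 : ∀ n, 1 ≤ n → 0 ≤ X n 0) (hH : Summable fun n => X (n + 1) 0 ^ 2) :
    ∃ M : ℝ, ∀ n, 1 ≤ n → ∀ t, τ ≤ t → lam n ^ (β - 2 + 1 / 1000) * X n t ≤ M := by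
  have hβ : β ≠ 0 := by linarith
  obtain ⟨s, hs, C, hC⟩ := hX.exists_lam_mul_le hβ hν hτ h0 hH
  obtain ⟨M, hM⟩ := (hX.shift hs.1).exists_bound_of_lam_mul_le hβ1 hβ2 hν
    (fun n hn => by simpa using hX.nonneg h0 hn hs.1)
    (by simpa using hX.summable_sq hβ hν h0 hH hs.1) (by simpa using hC)
  refine ⟨M, fun n hn t ht => ?_⟩
  simpa using hM n hn (t - s) (by linarith [hs.2])

/-- One step of parabolic smoothing. -/
theorem IsViscousSolution.exists_bound_add {β ν σ ε M t₀ t₁ : ℝ} (hν : 0 < ν) (hε : ε ≤ 2)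
    (hσ : β - 2 + ε ≤ σ) (hβ : β ≠ 0) (ht₀ : 0 ≤ t₀) (ht₁ : t₀ < t₁) {X : ℕ → ℝ → ℝ}
    (hX : IsViscousSolution β ν (Set.Ici 0) X) (h0 : ∀ n, 1 ≤ n → 0 ≤ X n 0)
    (hM : ∀ n, 1 ≤ n → ∀ t, t₀ ≤ t → lam n ^ σ * X n t ≤ M) :
    ∃ M' : ℝ, ∀ n, 1 ≤ n → ∀ t, t₁ ≤ t → lam n ^ (σ + ε) * X n t ≤ M' := by
  have hM0 : 0 ≤ M := (mul_nonneg (Real.rpow_nonneg (lam_nonneg 1) σ)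
    (hX.nonneg h0 le_rfl ht₀)).trans (hM 1 le_rfl t₀ le_rfl)
  set K : ℝ := M ^ 2 * 2 ^ (2 * σ - β) with hK
  have hK0 : 0 ≤ K := by positivity
  refine ⟨K / ν + M / (ν * (t₁ - t₀)), fun n hn t ht => ?_⟩
  have hL1 := one_le_lam hn
  have hL0 := lam_pos hn
  set L := lam n with hL
  have hflux : ∀ s, t₀ ≤ s → lam (n - 1) ^ β * X (n - 1) s ^ 2 ≤ K * L ^ (2 - σ - ε) := by
    intro s hs
    obtain ⟨m, rfl⟩ := Nat.exists_eq_add_of_le' hn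
    rw [Nat.add_sub_cancel]
    rcases Nat.eq_zero_or_pos m with rfl | hm
    · rw [lam_zero, Real.zero_rpow hβ, zero_mul]
      positivity
    have hl := lam_pos hm
    have h1 : X m s ≤ M / lam m ^ σ := by
      rw [le_div_iff₀ (by positivity), mul_comm]
      exact hM m hm s hs
    have h2 : X m s ^ 2 ≤ (M / lam m ^ σ) ^ 2 :=
      pow_le_pow_left₀ (hX.nonneg h0 hm (ht₀.trans hs)) h1 2
    calc lam m ^ β * X m s ^ 2 ≤ lam m ^ β * (M / lam m ^ σ) ^ 2 := by gcongr
      _ = K * L ^ (β - 2 * σ) := by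
          rw [hK, hL, lam_succ hm, Real.mul_rpow zero_le_two hl.le,
            ← neg_sub β (2 * σ), Real.rpow_neg zero_le_two, Real.rpow_sub hl,
            two_mul σ, Real.rpow_add hl]
          field_simp
      _ ≤ K * L ^ (2 - σ - ε) := by
          refine mul_le_mul_of_nonneg_left ?_ hK0
          exact Real.rpow_le_rpow_of_exponent_le hL1 (by linarith)
  set B : ℝ := K / ν * L ^ (-(σ + ε)) with hB
  set A : ℝ := M * L ^ (-σ) with hA
  have hA0 : 0 ≤ A := by positivity
  have hBμ : ν * L ^ 2 * B = K * L ^ (2 - σ - ε) := by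
    have : L ^ (2 - σ - ε) = L ^ 2 * L ^ (-(σ + ε)) := by
      rw [← Real.rpow_natCast, ← Real.rpow_add hL0]
      congr 1
      push_cast
      ring
    rw [this, hB]
    field_simp
  have hcomp := nonneg_of_linear_ode (t₀ := t₀) (T := t)
    (f := fun s => B + A * Real.exp (-(ν * L ^ 2) * (s - t₀)) - X n s)
    (a := fun _ => ν * L ^ 2) (b := fun s => (ν * L ^ 2 * B - lam (n - 1) ^ β * X (n - 1) s ^ 2)
      + L ^ β * X n s * X (n + 1) s) (fun s hs => ?_) continuousOn_const (fun s hs => ?_) ?_ t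
      ⟨ht₁.le.trans ht, le_rfl⟩
  · have hexp : Real.exp (-(ν * L ^ 2) * (t - t₀)) ≤ 1 / (ν * (t₁ - t₀)) * L ^ (-ε) := by
      have hμ : 0 < ν * (t₁ - t₀) := mul_pos hν (by linarith)
      have h1 : ν * (t₁ - t₀) * L ^ ε ≤ Real.exp (ν * L ^ 2 * (t - t₀)) := by
        have h2 : L ^ ε ≤ L ^ 2 := by
          rw [← Real.rpow_natCast]
          exact Real.rpow_le_rpow_of_exponent_le hL1 (by simpa using hε)
        calc ν * (t₁ - t₀) * L ^ ε ≤ ν * (t - t₀) * L ^ 2 := by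
              have : 0 ≤ t - t₀ := by linarith
              gcongr
          _ ≤ Real.exp (ν * L ^ 2 * (t - t₀)) := by
              have := Real.add_one_le_exp (ν * L ^ 2 * (t - t₀))
              linarith
      rw [neg_mul, Real.exp_neg, Real.rpow_neg hL0.le, one_div, ← mul_inv]
      exact inv_anti₀ (by positivity) h1
    have hle : X n t ≤ B + A * (1 / (ν * (t₁ - t₀)) * L ^ (-ε)) := by
      have := mul_le_mul_of_nonneg_left hexp hA0
      linarith
    refine (mul_le_mul_of_nonneg_left hle (by positivity)).trans_eq ?_
    rw [hB, hA, Real.rpow_neg hL0.le, Real.rpow_neg hL0.le, Real.rpow_neg hL0.le,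
      Real.rpow_add hL0]
    have : ν * (t₁ - t₀) ≠ 0 := (mul_pos hν (by linarith)).ne'
    have : t₁ - t₀ ≠ 0 := by linarith
    field_simp
  · have hs0 : 0 ≤ s := ht₀.trans hs.1
    have h1 : HasDerivWithinAt (X n) _ (Set.Icc t₀ t) s :=
      (hX n hn s hs0).mono fun u hu => ht₀.trans hu.1
    have h2 : HasDerivAt (fun s => B + A * Real.exp (-(ν * L ^ 2) * (s - t₀)))
        (A * (Real.exp (-(ν * L ^ 2) * (s - t₀)) * (-(ν * L ^ 2) * 1))) s :=
      ((((hasDerivAt_id s).sub_const t₀).const_mul _).exp.const_mul A).const_add B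
    refine (h2.hasDerivWithinAt.sub h1).congr_deriv ?_
    ring
  · have h1 := hX.nonneg h0 hn (ht₀.trans hs.1)
    have h2 := hX.nonneg h0 (Nat.le_add_left 1 n) (ht₀.trans hs.1)
    have h3 := hflux s hs.1
    have h4 : 0 ≤ L ^ β * X n s * X (n + 1) s := by positivity
    rw [hBμ]
    linarith
  · have h1 : X n t₀ ≤ A := by
      rw [hA, Real.rpow_neg hL0.le, ← div_eq_mul_inv, le_div_iff₀ (by positivity), mul_comm]
      exact hM n hn t₀ le_rfl
    have h2 : 0 ≤ B := by positivity
    simp only [sub_self, mul_zero, Real.exp_zero, mul_one]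
    linarith

theorem IsViscousSolution.exists_bound {β ν : ℝ} (hβ1 : 2 < β) (hβ2 : β ≤ 5 / 2)
    (hν : 0 < ν) {X : ℕ → ℝ → ℝ} (hX : IsViscousSolution β ν (Set.Ici 0) X)
    (h0 : ∀ n, 1 ≤ n → 0 ≤ X n 0) (hH : Summable fun n => X (n + 1) 0 ^ 2) (k : ℕ) {τ : ℝ}
    (hτ : 0 < τ) : ∃ M : ℝ, ∀ n, 1 ≤ n → ∀ t, τ ≤ t →
      lam n ^ (β - 2 + (k + 1) * (1 / 1000)) * X n t ≤ M := by
  induction k generalizing τ with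
  | zero => simpa using hX.exists_bound_after hβ1 hβ2 hν hτ h0 hH
  | succ k ih =>
    obtain ⟨M, hM⟩ := ih (half_pos hτ)
    obtain ⟨M', hM'⟩ := hX.exists_bound_add hν (by norm_num : (1 / 1000 : ℝ) ≤ 2)
      (by have : (0 : ℝ) ≤ k := Nat.cast_nonneg k
          linarith) (by linarith) (half_pos hτ).le (half_lt_self hτ) h0 hM
    refine ⟨M', fun n hn t ht => ?_⟩
    convert hM' n hn t ht using 3
    push_cast
    ring

/-- for `β ∈ (2, 5/2]` and `ν > 0`, every nonnegative square-summable
initial condition gives rise to a unique weak solution on `[0,∞)`, and this solution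
is smooth. -/
theorem viscous_wellposedness_and_smoothness
    (β ν : ℝ) (hβ1 : 2 < β) (hβ2 : β ≤ 5 / 2) (hν : 0 < ν)
    (x : ℕ → ℝ) (hxpos : ∀ n, 1 ≤ n → 0 ≤ x n)
    (hxH : Summable fun n => x (n + 1) ^ 2) :
    ∃ X : ℕ → ℝ → ℝ,
      (IsViscousSolution β ν (Set.Ici 0) X ∧ (∀ n, 1 ≤ n → X n 0 = x n)) ∧
      (∀ Y : ℕ → ℝ → ℝ,
        IsViscousSolution β ν (Set.Ici 0) Y → (∀ n, 1 ≤ n → Y n 0 = x n) →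
        ∀ n, 1 ≤ n → ∀ t ∈ Set.Ici (0 : ℝ), Y n t = X n t) ∧
      (∀ γ : ℝ, 0 < γ → ∀ t : ℝ, 0 < t →
        ∃ C : ℝ, ∀ n, 1 ≤ n → lam n ^ γ * X n t ≤ C) := by
  obtain ⟨X, -, hX, hX0, -⟩ := exists_solution (by linarith : 0 < β) (by linarith) hν hxpos hxH
  have h0 : ∀ n, 1 ≤ n → 0 ≤ X n 0 := fun n hn => (hX0 n hn).symm ▸ hxpos n hn
  have hH : Summable fun n => X (n + 1) 0 ^ 2 := by
    simpa only [hX0 _ (Nat.le_add_left 1 _)] using hxH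
  refine ⟨X, ⟨hX, hX0⟩, fun Y hY hY0 n hn t ht => ?_, fun γ _ t ht => ?_⟩
  · exact (hX.eq (by linarith) (by linarith) hν hY
      (fun n hn => (hX0 n hn).trans (hY0 n hn).symm) h0 hH hn ht).symm
  · obtain ⟨k, hk⟩ := exists_nat_ge (1000 * γ)
    obtain ⟨M, hM⟩ := hX.exists_bound hβ1 hβ2 hν h0 hH k ht
    refine ⟨M, fun n hn => le_trans ?_ (hM n hn t le_rfl)⟩
    have := hX.nonneg h0 hn ht.le
    gcongr
    · exact one_le_lam hn
    · linarith
end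

section
/- Let β = 5/2. There exists γ₀ > 1/2 such that for every γ ∈ (1/2, γ₀) the following holds: for every initial condition x = (x_n)_{n≥1} with x_n ≥ 0 for all n ≥ 1 and sup_{n≥1} (λ_n^γ x_n) < ∞, there is a global-in-time weak solution X = (X_n)_{n≥1} of the inviscid dyadic model on [0,∞) with initial condition x such that sup_{t≥0} sup_{n≥1} (λ_n^γ X_n(t)) < ∞. -/
/-- `X` is a weak solution of the inviscid dyadic model with parameter `β` on `I`. -/
def IsInviscidSolution (β : ℝ) (I : Set ℝ) (X : ℕ → ℝ → ℝ) : Prop :=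
  ∀ n, 1 ≤ n → ∀ t ∈ I, HasDerivWithinAt (X n)
    (lam (n - 1) ^ β * (X (n - 1) t) ^ 2 - lam n ^ β * X n t * X (n + 1) t) I t

namespace DyadicModel

open Filter Topology Set

/-! ### The invariant region

After rescaling, the model reads `dY_n/dt = k_n (Y_{n-1}² - c Y_n Y_{n+1})` with `k_{n+1} = r k_n`.
The polytope `0 ≤ Y_n ≤ 1`, `5/3 Y_n - 10/9 ≤ Y_{n+1} ≤ (Y_n + 2)/3` is invariant when `c` is close
to `2` and `r` is close to `4`. The next three lemmas bound from below the derivative of each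
constraint along the flow by a multiple of the constraint itself. -/

theorem one_sub_face_bound {c w x y : ℝ} (hc : 99 / 50 ≤ c) (hw : 0 ≤ w) (hw1 : w ≤ 1)
    (hx : 0 ≤ x) (hx1 : x ≤ 1) (hy : 0 ≤ y) (h : 5 / 3 * x - 10 / 9 ≤ y) :
    0 ≤ c * (x * y) - w ^ 2 + 40 * (1 - x) := by
  have h1 : w ^ 2 ≤ 1 := by nlinarith
  have h2 : 99 / 50 * (x * y) ≤ c * (x * y) :=
    mul_le_mul_of_nonneg_right hc (mul_nonneg hx hy)
  nlinarith [mul_nonneg hx (sub_nonneg.2 h)]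

theorem lower_face_bound {c r w x y z : ℝ} (hc : 99 / 50 ≤ c) (hc2 : c ≤ 2)
    (hr : 199 / 50 ≤ r) (hr4 : r ≤ 4) (hw : 0 ≤ w) (hw1 : w ≤ 1)
    (hx : 0 ≤ x) (hx1 : x ≤ 1) (hy : 0 ≤ y) (hy1 : y ≤ 1) (h : 5 / 3 * x - 10 / 9 ≤ y)
    (hz0 : 0 ≤ z) (hz : z ≤ (y + 2) / 3) :
    0 ≤ r * (x ^ 2 - c * (y * z)) - 5 / 3 * (w ^ 2 - c * (x * y))
      + 40 * (y - (5 / 3 * x - 10 / 9)) := by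
  have h1 : w ^ 2 ≤ 1 := by nlinarith
  have h2 : 99 / 50 * (x * y) ≤ c * (x * y) :=
    mul_le_mul_of_nonneg_right hc (mul_nonneg hx hy)
  have h3 : r * (c * (y * z)) ≤ 4 * (2 * (y * ((y + 2) / 3))) := by
    have hyz := mul_nonneg hy hz0
    have hc0 : 0 ≤ c := by linarith
    gcongr
  have h4 : 199 / 50 * x ^ 2 ≤ r * x ^ 2 := mul_le_mul_of_nonneg_right hr (sq_nonneg x)
  have key : 0 ≤ 199 / 50 * x ^ 2 - 4 * (2 * (y * ((y + 2) / 3)))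
      - 5 / 3 * (1 - 99 / 50 * (x * y)) + 40 * (y - (5 / 3 * x - 10 / 9)) := by
    obtain ⟨s, hs⟩ : ∃ s, y = 5 / 3 * x - 10 / 9 + s := ⟨_, (add_sub_cancel _ _).symm⟩
    have hs0 : 0 ≤ s := by linarith
    nlinarith [mul_nonneg hx hs0, mul_nonneg hy hs0, mul_nonneg hx hy,
      mul_nonneg hs0 (sub_nonneg.2 hx1), mul_nonneg hs0 (sub_nonneg.2 hy1),
      mul_nonneg (sub_nonneg.2 hx1) hy, mul_nonneg (sub_nonneg.2 hx1) (sub_nonneg.2 hy1),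
      sq_nonneg (x - 2 / 3)]
  linarith

theorem upper_face_bound {c r w x y z : ℝ} (hc : 99 / 50 ≤ c) (hc2 : c ≤ 2)
    (hr : 199 / 50 ≤ r) (hr4 : r ≤ 4) (hx : 0 ≤ x) (hx1 : x ≤ 1) (hy : 0 ≤ y) (hy1 : y ≤ 1)
    (hxw : x ≤ (w + 2) / 3) (h : y ≤ (x + 2) / 3) (hz0 : 0 ≤ z)
    (hz : 5 / 3 * y - 10 / 9 ≤ z) :
    0 ≤ 1 / 3 * (w ^ 2 - c * (x * y)) - r * (x ^ 2 - c * (y * z))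
      + 40 * ((x + 2) / 3 - y) := by
  have h1 : y * (5 / 3 * y - 10 / 9) ≤ y * z := mul_le_mul_of_nonneg_left hz hy
  have h2 : 199 / 50 * (99 / 50 * (y * z)) ≤ r * (c * (y * z)) := by
    have := mul_nonneg hy hz0
    gcongr
  have h3 : r * x ^ 2 ≤ 4 * x ^ 2 := mul_le_mul_of_nonneg_right hr4 (sq_nonneg x)
  have h4 : c * (x * y) ≤ 2 * (x * y) := mul_le_mul_of_nonneg_right hc2 (mul_nonneg hx hy)
  have key : 0 ≤ 1 / 3 * (w ^ 2 - 2 * (x * y))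
      - (4 * x ^ 2 - 199 / 50 * (99 / 50 * (y * (5 / 3 * y - 10 / 9))))
      + 40 * ((x + 2) / 3 - y) := by
    obtain ⟨s, rfl⟩ : ∃ s, y = (x + 2) / 3 - s := ⟨(x + 2) / 3 - y, by ring⟩
    have hs0 : 0 ≤ s := by linarith
    have hw2 : 2 * x * (3 * x - 2) - x ^ 2 ≤ w ^ 2 := by
      linarith [sq_nonneg (w - x), mul_nonneg hx (by linarith : 0 ≤ w - (3 * x - 2))]
    linarith [mul_nonneg hs0 (sub_nonneg.2 hx1), mul_nonneg hs0 (sub_nonneg.2 hy1),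
      mul_nonneg hx (sub_nonneg.2 hx1)]
  linarith

/-- The polytope of rescaled states that the flow leaves invariant. -/
structure InRegion (Y : ℕ → ℝ) : Prop where
  zero : Y 0 = 0
  nonneg : ∀ n, 0 ≤ Y n
  le_one : ∀ n, Y n ≤ 1
  lower : ∀ n, 5 / 3 * Y n - 10 / 9 ≤ Y (n + 1)
  upper : ∀ n, Y (n + 1) ≤ (Y n + 2) / 3

/-- The vector field of the rescaled model. -/
def field (c : ℝ) (k : ℕ → ℝ) (Y : ℕ → ℝ) : ℕ → ℝ
  | 0 => 0
  | n + 1 => k (n + 1) * (Y n ^ 2 - c * (Y (n + 1) * Y (n + 2)))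

/-- One explicit Euler step of size `ε` for the model truncated at level `N`, where the components
beyond `N` are kept equal to the `N`-th one. -/
def eulerStep (c : ℝ) (k : ℕ → ℝ) (N : ℕ) (ε : ℝ) (Y : ℕ → ℝ) (n : ℕ) : ℝ :=
  Y (min n N) + ε * field c k Y (min n N)

theorem abs_field_le {c : ℝ} (hc0 : 0 ≤ c) (hc2 : c ≤ 2) {k : ℕ → ℝ} (hk : ∀ n, 0 < k n)
    {Y : ℕ → ℝ} (hY : InRegion Y) (n : ℕ) : |field c k Y n| ≤ 2 * k n := by
  cases n with
  | zero => simpa [field] using (hk 0).le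
  | succ n =>
    have h0 := hY.nonneg n
    have h1 := hY.le_one n
    have hxy0 := mul_nonneg (hY.nonneg (n + 1)) (hY.nonneg (n + 2))
    have hxy1 := mul_le_one₀ (hY.le_one (n + 1)) (hY.nonneg (n + 2)) (hY.le_one (n + 2))
    rw [field, abs_mul, abs_of_pos (hk _), mul_comm]
    refine mul_le_mul_of_nonneg_right ?_ (hk _).le
    rw [abs_le]
    constructor <;> nlinarith

theorem constraint_step_nonneg {κ D G : ℝ} (hκ : 0 ≤ κ) (hκ1 : κ * 40 ≤ 1) (hG : 0 ≤ G)
    (hD : 0 ≤ D + 40 * G) : 0 ≤ G + κ * D := by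
  nlinarith [mul_nonneg hκ hD, mul_nonneg hG (sub_nonneg.2 hκ1)]

/-- A sufficiently small Euler step preserves the invariant region. -/
theorem InRegion.eulerStep {c r : ℝ} (hc : 99 / 50 ≤ c) (hc2 : c ≤ 2) (hr : 199 / 50 ≤ r)
    (hr4 : r ≤ 4) {k : ℕ → ℝ} (hk : ∀ n, 0 < k n) (hkr : ∀ n, k (n + 1) = r * k n)
    {N : ℕ} {ε : ℝ} (hε : 0 ≤ ε) (hεk : ∀ n ≤ N, ε * k n * 40 ≤ 1)
    {Y : ℕ → ℝ} (hY : InRegion Y) : InRegion (eulerStep c k N ε Y) := by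
  have nonneg : ∀ n ≤ N, 0 ≤ Y n + ε * field c k Y n := by
    intro n hn
    cases n with
    | zero => simp [field, hY.zero]
    | succ n =>
      have := constraint_step_nonneg (D := Y n ^ 2 - c * (Y (n + 1) * Y (n + 2)))
        (mul_nonneg hε (hk _).le) (hεk _ hn) (hY.nonneg (n + 1)) (by
          have h0 := hY.nonneg (n + 1)
          have : c * (Y (n + 1) * Y (n + 2)) ≤ 2 * (Y (n + 1) * 1) := by
            have := hY.nonneg (n + 2)
            gcongr
            exact hY.le_one _
          nlinarith [sq_nonneg (Y n)])
      simpa only [field, mul_assoc] using this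
  have le_one : ∀ n ≤ N, Y n + ε * field c k Y n ≤ 1 := by
    intro n hn
    cases n with
    | zero => simp [field, hY.zero]
    | succ n =>
      have := constraint_step_nonneg (mul_nonneg hε (hk _).le) (hεk _ hn)
        (sub_nonneg.2 (hY.le_one (n + 1)))
        (one_sub_face_bound hc (hY.nonneg n) (hY.le_one n) (hY.nonneg _) (hY.le_one _)
          (hY.nonneg _) (hY.lower (n + 1)))
      rw [field]
      linarith
  have pair : ∀ n, n + 1 ≤ N →
      5 / 3 * (Y n + ε * field c k Y n) - 10 / 9 ≤ Y (n + 1) + ε * field c k Y (n + 1) ∧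
      Y (n + 1) + ε * field c k Y (n + 1) ≤ (Y n + ε * field c k Y n + 2) / 3 := by
    intro n hn
    cases n with
    | zero =>
      have h1 := nonneg 1 hn
      have h2 := hY.upper 0
      have h3 : 0 ≤ ε * (k 1 * (c * (Y 1 * Y 2))) :=
        mul_nonneg hε (mul_nonneg (hk 1).le (mul_nonneg (by linarith)
          (mul_nonneg (hY.nonneg 1) (hY.nonneg 2))))
      simp only [field, hY.zero, zero_add] at h1 h2 ⊢
      constructor <;> linarith
    | succ n =>
      have hκ := mul_nonneg hε (hk (n + 1)).le
      have hκ1 := hεk (n + 1) (by omega)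
      have hl := constraint_step_nonneg hκ hκ1 (sub_nonneg.2 (hY.lower (n + 1)))
        (lower_face_bound hc hc2 hr hr4 (hY.nonneg n) (hY.le_one n) (hY.nonneg _) (hY.le_one _)
          (hY.nonneg _) (hY.le_one _) (hY.lower (n + 1)) (hY.nonneg _) (hY.upper (n + 2)))
      have hu := constraint_step_nonneg hκ hκ1 (sub_nonneg.2 (hY.upper (n + 1)))
        (upper_face_bound hc hc2 hr hr4 (hY.nonneg _) (hY.le_one _)
          (hY.nonneg _) (hY.le_one _) (hY.upper n) (hY.upper (n + 1)) (hY.nonneg _)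
          (hY.lower (n + 2)))
      simp only [field, hkr (n + 1)]
      constructor <;> linarith
  refine ⟨?_, fun n => nonneg _ (min_le_right _ _), fun n => le_one _ (min_le_right _ _),
    fun n => ?_, fun n => ?_⟩
  · simp [DyadicModel.eulerStep, field, hY.zero]
  all_goals
    rcases le_or_gt (n + 1) N with h | h
    · have := pair n h
      simp only [DyadicModel.eulerStep, min_eq_left h, min_eq_left (by omega : n ≤ N)]
      tauto
    · have h0 := nonneg N le_rfl
      have h1 := le_one N le_rfl
      simp only [DyadicModel.eulerStep, min_eq_right h.le, min_eq_right (by omega : N ≤ n)]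
      linarith

/-! ### Passing to the limit in the Euler scheme -/

theorem abs_sub_le_of_step {f : ℕ → ℝ} {δ : ℝ} (h : ∀ j, |f (j + 1) - f j| ≤ δ) (j i : ℕ) :
    |f (j + i) - f j| ≤ i * δ := by
  induction i with
  | zero => simp
  | succ i ih =>
    have := abs_sub_le (f (j + i + 1)) (f (j + i)) (f j)
    have := h (j + i)
    rw [← add_assoc]
    push_cast
    linarith

/-- A discrete first-order Taylor estimate. -/
theorem abs_sub_sub_le_of_step {v f : ℕ → ℝ} {ε L : ℝ} (hε : 0 ≤ ε) (hL : 0 ≤ L)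
    (hv : ∀ j, v (j + 1) = v j + ε * f j) (hf : ∀ j, |f (j + 1) - f j| ≤ ε * L) (j i : ℕ) :
    |v (j + i) - v j - i * ε * f j| ≤ L * (i * ε) ^ 2 := by
  induction i with
  | zero => simp
  | succ i ih =>
    have h1 := abs_sub_le_of_step hf j i
    have h2 : v (j + (i + 1)) - v j - (i + 1 : ℕ) * ε * f j
        = (v (j + i) - v j - i * ε * f j) + ε * (f (j + i) - f j) := by
      rw [← add_assoc, hv]
      push_cast
      ring
    have h3 : |ε * (f (j + i) - f j)| ≤ ε * (i * (ε * L)) := by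
      rw [abs_mul, abs_of_nonneg hε]
      exact mul_le_mul_of_nonneg_left h1 hε
    have h4 : 0 ≤ L * ε ^ 2 * (i + 1) := by positivity
    rw [h2]
    refine (abs_add_le _ _).trans ?_
    push_cast
    nlinarith

theorem hasDerivWithinAt_of_forward_taylor {Y F : ℝ → ℝ} {L : ℝ}
    (hF : ∀ t s, 0 ≤ t → t ≤ s → |F s - F t| ≤ L * (s - t))
    (hY : ∀ t s, 0 ≤ t → t ≤ s → |Y s - Y t - (s - t) * F t| ≤ L * (s - t) ^ 2)
    {t : ℝ} (ht : 0 ≤ t) : HasDerivWithinAt Y (F t) (Ici 0) t := by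
  have hL : 0 ≤ L := by
    have := (abs_nonneg _).trans (hF 0 1 le_rfl zero_le_one)
    linarith
  have hbound : ∀ s ∈ Ici (0 : ℝ), |Y s - Y t - (s - t) * F t| ≤ 2 * L * |s - t| ^ 2 := by
    intro s hs
    rw [sq_abs]
    rcases le_total t s with h | h
    · nlinarith [hY t s ht h, mul_nonneg hL (sq_nonneg (s - t))]
    · have h1 := hY s t hs h
      have h2 : |(t - s) * (F t - F s)| ≤ (t - s) * (L * (t - s)) := by
        rw [abs_mul, abs_of_nonneg (sub_nonneg.2 h)]
        exact mul_le_mul_of_nonneg_left (hF s t hs h) (sub_nonneg.2 h)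
      have h3 : Y s - Y t - (s - t) * F t
          = (t - s) * (F t - F s) - (Y t - Y s - (t - s) * F s) := by ring
      rw [h3]
      have := abs_sub ((t - s) * (F t - F s)) (Y t - Y s - (t - s) * F s)
      nlinarith
  have hO : (fun s => Y s - Y t - (s - t) * F t) =O[𝓝[Ici 0] t] fun s => ‖s - t‖ ^ 2 := by
    refine Asymptotics.IsBigO.of_bound (2 * L) ?_
    filter_upwards [self_mem_nhdsWithin] with s hs
    simpa using hbound s hs
  have h0 : HasDerivWithinAt (fun s => Y s - Y t - (s - t) * F t) 0 (Ici 0) t := by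
    have := (hO.hasFDerivWithinAt ht one_lt_two).hasDerivWithinAt
    simpa using this
  have h1 : HasDerivWithinAt (fun s => Y t + (s - t) * F t) (F t) (Ici 0) t := by
    simpa using (((hasDerivWithinAt_id t (Ici 0)).sub_const t).mul_const (F t)).const_add (Y t)
  have h2 := h0.add h1
  rw [zero_add] at h2
  refine h2.congr_of_eventuallyEq (Eventually.of_forall fun s => ?_) ?_
  · simp
  · simp

/-- The Euler trajectory, started from `y` truncated at level `N`. -/
def eulerSeq (c : ℝ) (k : ℕ → ℝ) (N : ℕ) (ε : ℝ) (y : ℕ → ℝ) : ℕ → ℕ → ℝ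
  | 0 => fun n => y (min n N)
  | j + 1 => eulerStep c k N ε (eulerSeq c k N ε y j)

theorem InRegion.of_le_two_thirds {y : ℕ → ℝ} (hy0 : y 0 = 0) (hy : ∀ n, 0 ≤ y n)
    (hy' : ∀ n, y n ≤ 2 / 3) : InRegion y where
  zero := hy0
  nonneg := hy
  le_one n := by linarith [hy' n]
  lower n := by linarith [hy' n, hy (n + 1)]
  upper n := by linarith [hy' (n + 1), hy n]

theorem eulerSeq_apply_succ {c : ℝ} {k : ℕ → ℝ} {N : ℕ} {ε : ℝ} {y : ℕ → ℝ} {n : ℕ} (hn : n ≤ N)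
    (j : ℕ) : eulerSeq c k N ε y (j + 1) n
      = eulerSeq c k N ε y j n + ε * field c k (eulerSeq c k N ε y j) n := by
  simp [eulerSeq, eulerStep, hn]

/-- A Lipschitz bound in time for the `n`-th component of the field along a trajectory. -/
def lipBound (k : ℕ → ℝ) : ℕ → ℝ
  | 0 => 0
  | n + 1 => k (n + 1) * (4 * (k n + k (n + 1) + k (n + 2)))

theorem lipBound_nonneg {k : ℕ → ℝ} (hk : ∀ n, 0 < k n) (n : ℕ) : 0 ≤ lipBound k n := by
  cases n with
  | zero => exact le_rfl
  | succ n =>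
    have := hk n
    have := hk (n + 1)
    have := hk (n + 2)
    rw [lipBound]
    positivity

theorem abs_field_sub_le {c : ℝ} (hc0 : 0 ≤ c) (hc2 : c ≤ 2) {k : ℕ → ℝ} (hk : ∀ n, 0 < k n)
    {Y Z : ℕ → ℝ} (hY : InRegion Y) (hZ : InRegion Z) {ε : ℝ} {n : ℕ}
    (h : ∀ m ≤ n + 1, |Z m - Y m| ≤ ε * (2 * k m)) :
    |field c k Z n - field c k Y n| ≤ ε * lipBound k n := by
  cases n with
  | zero => simp [field, lipBound]
  | succ n =>
    have h0 := h n (by omega)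
    have h1 := h (n + 1) (by omega)
    have h2 := h (n + 2) (by omega)
    have e : field c k Z (n + 1) - field c k Y (n + 1) = k (n + 1) *
        ((Z n - Y n) * (Z n + Y n) - (c * ((Z (n + 1) - Y (n + 1)) * Z (n + 2))
          + c * ((Z (n + 2) - Y (n + 2)) * Y (n + 1)))) := by
      simp only [field]
      ring
    have a0 : |(Z n - Y n) * (Z n + Y n)| ≤ ε * (2 * k n) * 2 := by
      rw [abs_mul]
      refine mul_le_mul h0 ?_ (abs_nonneg _) ((abs_nonneg _).trans h0)
      rw [abs_of_nonneg (add_nonneg (hZ.nonneg n) (hY.nonneg n))]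
      linarith [hZ.le_one n, hY.le_one n]
    have aux : ∀ {d u b : ℝ}, |d| ≤ b → 0 ≤ u → u ≤ 1 → |c * (d * u)| ≤ 2 * (b * 1) := by
      intro d u b hd hu hu1
      rw [abs_mul, abs_mul, abs_of_nonneg hc0, abs_of_nonneg hu]
      have := (abs_nonneg _).trans hd
      gcongr
    have a1 := aux h1 (hZ.nonneg (n + 2)) (hZ.le_one (n + 2))
    have a2 := aux h2 (hY.nonneg (n + 1)) (hY.le_one (n + 1))
    rw [e, abs_mul, abs_of_pos (hk _), lipBound, mul_left_comm ε]
    refine mul_le_mul_of_nonneg_left ?_ (hk _).le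
    refine (abs_sub _ _).trans ?_
    refine (add_le_add_right (abs_add_le _ _) _).trans ?_
    linarith

theorem abs_natFloor_sub_mul_sub_le {ε t s : ℝ} (hε : 0 < ε) (ht : 0 ≤ t) (hts : t ≤ s) :
    |((⌊s / ε⌋₊ - ⌊t / ε⌋₊ : ℕ) : ℝ) * ε - (s - t)| ≤ ε := by
  have hle : ⌊t / ε⌋₊ ≤ ⌊s / ε⌋₊ := Nat.floor_le_floor (by gcongr)
  rw [Nat.cast_sub hle]
  have h1 := (le_div_iff₀ hε).1 (Nat.floor_le (div_nonneg ht hε.le))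
  have h2 := (le_div_iff₀ hε).1 (Nat.floor_le (div_nonneg (ht.trans hts) hε.le))
  have h3 := (div_lt_iff₀ hε).1 (Nat.lt_floor_add_one (t / ε))
  have h4 := (div_lt_iff₀ hε).1 (Nat.lt_floor_add_one (s / ε))
  rw [abs_le]
  constructor <;> nlinarith

/-- Global existence for the rescaled model, for small bounded data. -/
theorem exists_rescaled_solution {c r : ℝ} (hc : 99 / 50 ≤ c) (hc2 : c ≤ 2) (hr : 199 / 50 ≤ r)
    (hr4 : r ≤ 4) {k : ℕ → ℝ} (hk : ∀ n, 0 < k n) (hkr : ∀ n, k (n + 1) = r * k n)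
    {y : ℕ → ℝ} (hy0 : y 0 = 0) (hy : ∀ n, 0 ≤ y n) (hy' : ∀ n, y n ≤ 2 / 3) :
    ∃ Y : ℝ → ℕ → ℝ, Y 0 = y ∧ (∀ t, Y t 0 = 0) ∧ (∀ t n, Y t n ≤ 1) ∧
      ∀ n, ∀ t, 0 ≤ t → HasDerivWithinAt (fun s => Y s n) (field c k (Y t) n) (Ici 0) t := by
  have hc0 : 0 ≤ c := by linarith
  have hmono : Monotone k := monotone_nat_of_le_succ fun n => by
    rw [hkr]
    nlinarith [hk n]
  let ε : ℕ → ℝ := fun N => 1 / (((N : ℝ) + 1) * (1 + 40 * k N))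
  have hε : ∀ N, 0 < ε N := fun N => by
    have := hk N
    positivity
  have hεk : ∀ N, ∀ n ≤ N, ε N * k n * 40 ≤ 1 := fun N n hn => by
    have h1 := hk N
    have h2 := hmono hn
    have h3 : (0 : ℝ) ≤ N := Nat.cast_nonneg N
    simp only [ε]
    rw [mul_assoc, one_div_mul_eq_div, div_le_one (by positivity)]
    nlinarith [mul_nonneg h3 h1.le]
  have hεlim : Tendsto ε atTop (𝓝 0) := by
    refine squeeze_zero (fun N => (hε N).le) (fun N => ?_)
      (tendsto_one_div_add_atTop_nhds_zero_nat (𝕜 := ℝ))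
    have h1 := hk N
    refine one_div_le_one_div_of_le (by positivity) ?_
    exact le_mul_of_one_le_right (by positivity) (by linarith)
  let V : ℕ → ℕ → ℕ → ℝ := fun N => eulerSeq c k N (ε N) y
  have hV : ∀ N j, InRegion (V N j) := fun N j => by
    induction j with
    | zero =>
      exact InRegion.of_le_two_thirds (by simp [V, eulerSeq, hy0]) (fun n => hy _) fun n => hy' _
    | succ j ih => exact ih.eulerStep hc hc2 hr hr4 hk hkr (hε N).le (hεk N)
  have hstep : ∀ N j, ∀ n ≤ N, V N (j + 1) n = V N j n + ε N * field c k (V N j) n :=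
    fun N j n hn => eulerSeq_apply_succ hn j
  have hdiff : ∀ N j, ∀ n ≤ N, |V N (j + 1) n - V N j n| ≤ ε N * (2 * k n) := by
    intro N j n hn
    rw [hstep N j n hn, add_sub_cancel_left, abs_mul, abs_of_pos (hε N)]
    exact mul_le_mul_of_nonneg_left (abs_field_le hc0 hc2 hk (hV N j) n) (hε N).le
  have hfield : ∀ N j n, n + 1 ≤ N →
      |field c k (V N (j + 1)) n - field c k (V N j) n| ≤ ε N * lipBound k n :=
    fun N j n hn => abs_field_sub_le hc0 hc2 hk (hV N j) (hV N (j + 1))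
      fun m hm => hdiff N j m (hm.trans hn)
  let A : ℕ → ℝ → ℕ → ℝ := fun N t => V N ⌊t / ε N⌋₊
  let U : Ultrafilter ℕ := hyperfilter ℕ
  have hU : (U : Filter ℕ) ≤ atTop := Nat.hyperfilter_le_atTop
  have hex : ∀ t n, ∃ l ∈ Icc (0 : ℝ) 1, Tendsto (fun N => A N t n) U (𝓝 l) := fun t n =>
    isCompact_Icc.ultrafilter_le_nhds (U.map fun N => A N t n) (tendsto_principal.2
      (Eventually.of_forall fun N => ⟨(hV N _).nonneg n, (hV N _).le_one n⟩))
  choose Y hY01 hYlim using hex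
  have hεU : Tendsto ε U (𝓝 0) := hεlim.mono_left hU
  have hfieldlim : ∀ t n, Tendsto (fun N => field c k (A N t) n) U (𝓝 (field c k (Y t) n)) := by
    intro t n
    cases n with
    | zero => exact tendsto_const_nhds
    | succ n =>
      exact (((hYlim t n).pow 2).sub (((hYlim t (n + 1)).mul (hYlim t (n + 2))).const_mul c)
        ).const_mul (k (n + 1))
  refine ⟨Y, funext fun n => ?_, fun t => ?_, fun t n => (hY01 t n).2, fun n t ht => ?_⟩
  · refine tendsto_nhds_unique (hYlim 0 n) (tendsto_const_nhds.congr' ?_)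
    filter_upwards [hU (eventually_ge_atTop n)] with N hN
    have hN : n ≤ N := hN
    simp [A, V, eulerSeq, hN]
  · exact tendsto_nhds_unique (hYlim t 0)
      (tendsto_const_nhds.congr fun N => ((hV N _).zero).symm)
  · refine hasDerivWithinAt_of_forward_taylor (Y := fun s => Y s n)
      (F := fun s => field c k (Y s) n) (L := lipBound k n) ?_ ?_ ht
    · intro t s ht hts
      have hl : Tendsto (fun N => lipBound k n * (s - t + ε N)) U
          (𝓝 (lipBound k n * (s - t))) := by
        simpa using (hεU.const_add (s - t)).const_mul (lipBound k n)
      refine le_of_tendsto_of_tendsto ((hfieldlim s n).sub (hfieldlim t n)).abs hl ?_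
      filter_upwards [hU (eventually_ge_atTop (n + 1))] with N hN
      have hi := abs_natFloor_sub_mul_sub_le (hε N) ht hts
      have hle : ⌊t / ε N⌋₊ ≤ ⌊s / ε N⌋₊ :=
        Nat.floor_le_floor (div_le_div_of_nonneg_right hts (hε N).le)
      have := abs_sub_le_of_step (f := fun j => field c k (V N j) n)
        (fun j => hfield N j n hN) ⌊t / ε N⌋₊ (⌊s / ε N⌋₊ - ⌊t / ε N⌋₊)
      rw [Nat.add_sub_cancel' hle] at this
      refine this.trans ?_
      nlinarith [abs_le.1 hi, lipBound_nonneg hk n]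
    · intro t s ht hts
      have hl : Tendsto (fun N => lipBound k n * (s - t + ε N) ^ 2 + ε N * (2 * k n)) U
          (𝓝 (lipBound k n * (s - t) ^ 2)) := by
        simpa using (((hεU.const_add (s - t)).pow 2).const_mul (lipBound k n)).add
          (hεU.mul_const (2 * k n))
      refine le_of_tendsto_of_tendsto
        (((hYlim s n).sub (hYlim t n)).sub ((hfieldlim t n).const_mul (s - t))).abs hl ?_
      filter_upwards [hU (eventually_ge_atTop (n + 1))] with N hN
      have hi := abs_natFloor_sub_mul_sub_le (hε N) ht hts
      have hle : ⌊t / ε N⌋₊ ≤ ⌊s / ε N⌋₊ :=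
        Nat.floor_le_floor (div_le_div_of_nonneg_right hts (hε N).le)
      have hN' : n ≤ N := Nat.le_of_succ_le hN
      have h1 := abs_sub_sub_le_of_step (v := fun j => V N j n)
        (f := fun j => field c k (V N j) n) (hε N).le (lipBound_nonneg hk n)
        (fun j => hstep N j n hN') (fun j => hfield N j n hN) ⌊t / ε N⌋₊
        (⌊s / ε N⌋₊ - ⌊t / ε N⌋₊)
      rw [Nat.add_sub_cancel' hle] at h1
      have h2 := abs_field_le hc0 hc2 hk (hV N ⌊t / ε N⌋₊) n
      set i : ℝ := ((⌊s / ε N⌋₊ - ⌊t / ε N⌋₊ : ℕ) : ℝ)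
      have hi0 : 0 ≤ i := Nat.cast_nonneg _
      have h3 : |(i * ε N - (s - t)) * field c k (A N t) n| ≤ ε N * (2 * k n) := by
        rw [abs_mul]
        exact mul_le_mul hi h2 (abs_nonneg _) (hε N).le
      have h4 : lipBound k n * (i * ε N) ^ 2 ≤ lipBound k n * (s - t + ε N) ^ 2 := by
        have := lipBound_nonneg hk n
        have := (hε N).le
        gcongr
        linarith [(abs_le.1 hi).2]
      have e : A N s n - A N t n - (s - t) * field c k (A N t) n
          = (A N s n - A N t n - i * ε N * field c k (A N t) n)
            + (i * ε N - (s - t)) * field c k (A N t) n := by ring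
      show |A N s n - A N t n - (s - t) * field c k (A N t) n| ≤ _
      rw [e]
      exact (abs_add_le _ _).trans (add_le_add (h1.trans h4) h3)

theorem lam_rpow {n : ℕ} (hn : n ≠ 0) (p : ℝ) : lam n ^ p = ((2 : ℝ) ^ p) ^ n := by
  rw [lam, if_neg hn, ← Real.rpow_natCast, ← Real.rpow_natCast, ← Real.rpow_mul zero_le_two,
    ← Real.rpow_mul zero_le_two, mul_comm]

theorem one_sub_le_two_rpow_neg {u : ℝ} (hu : 0 ≤ u) : 1 - u ≤ (2 : ℝ) ^ (-u) := by
  rw [Real.rpow_def_of_pos two_pos]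
  have h1 := Real.add_one_le_exp (Real.log 2 * -u)
  have h2 : Real.log 2 ≤ 1 := by linarith [Real.log_two_lt_d9]
  nlinarith

end DyadicModel

open DyadicModel in
/-- for `β = 5/2` there is `γ₀ > 1/2` such that for every
`γ ∈ (1/2, γ₀)` and every nonnegative initial condition bounded in the `λ_n^γ`
scaling, the inviscid dyadic model has a global weak solution which stays bounded
in the `λ_n^γ` scaling. -/
theorem inviscid_global_existence :
    ∃ γ₀ : ℝ, 1 / 2 < γ₀ ∧
      ∀ γ : ℝ, 1 / 2 < γ → γ < γ₀ →
      ∀ x : ℕ → ℝ, (∀ n, 1 ≤ n → 0 ≤ x n) →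
        (∃ C : ℝ, ∀ n, 1 ≤ n → lam n ^ γ * x n ≤ C) →
      ∃ X : ℕ → ℝ → ℝ,
        IsInviscidSolution (5 / 2) (Set.Ici 0) X ∧
        (∀ n, 1 ≤ n → X n 0 = x n) ∧
        (∃ C : ℝ, ∀ t ∈ Set.Ici (0 : ℝ), ∀ n, 1 ≤ n → lam n ^ γ * X n t ≤ C) := by
  refine ⟨1 / 2 + 1 / 400, by norm_num, fun γ hγ hγ₀ x hx ⟨C, hC⟩ => ?_⟩
  set g : ℝ := (2 : ℝ) ^ γ with hg
  set b : ℝ := (2 : ℝ) ^ (5 / 2 : ℝ) with hb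
  have hg0 : 0 < g := Real.rpow_pos_of_pos two_pos _
  have hb0 : 0 < b := Real.rpow_pos_of_pos two_pos _
  have hr_eq : b / g = 4 * (2 : ℝ) ^ (-(γ - 1 / 2)) := by
    rw [hg, hb, ← Real.rpow_sub two_pos, show (4 : ℝ) = 2 ^ (2 : ℝ) by norm_num,
      ← Real.rpow_add two_pos]
    ring_nf
  have hc_eq : b / g ^ 3 = 2 * (2 : ℝ) ^ (-(3 * (γ - 1 / 2))) := by
    rw [hg, hb, ← Real.rpow_natCast, ← Real.rpow_mul zero_le_two, ← Real.rpow_sub two_pos]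
    rw [← Real.rpow_one_add' zero_le_two (by linarith)]
    push_cast
    ring_nf
  have hr : 199 / 50 ≤ b / g := by
    rw [hr_eq]
    linarith [one_sub_le_two_rpow_neg (u := γ - 1 / 2) (by linarith)]
  have hr4 : b / g ≤ 4 := by
    rw [hr_eq]
    linarith [Real.rpow_le_one_of_one_le_of_nonpos one_le_two
      (by linarith : -(γ - 1 / 2) ≤ 0)]
  have hc : 99 / 50 ≤ b / g ^ 3 := by
    rw [hc_eq]
    linarith [one_sub_le_two_rpow_neg (u := 3 * (γ - 1 / 2)) (by linarith)]
  have hc2 : b / g ^ 3 ≤ 2 := by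
    rw [hc_eq]
    linarith [Real.rpow_le_one_of_one_le_of_nonpos one_le_two
      (by linarith : -(3 * (γ - 1 / 2)) ≤ 0)]
  set A : ℝ := 3 / 2 * (|C| + 1) with hA
  have hA0 : 0 < A := by positivity
  obtain ⟨Y, hY0, hYz, hY1, hY⟩ := exists_rescaled_solution hc hc2 hr hr4
    (k := fun n => A * (g ^ 2 / b) * (b ^ n / g ^ n)) (fun n => by positivity)
    (fun n => by
      simp only [pow_succ]
      field_simp)
    (y := fun n => if n = 0 then 0 else g ^ n * x n / A) (if_pos rfl)
    (fun n => by
      split_ifs with h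
      · exact le_rfl
      · have := hx n (Nat.one_le_iff_ne_zero.2 h)
        positivity)
    (fun n => by
      split_ifs with h
      · norm_num
      · have := hC n (Nat.one_le_iff_ne_zero.2 h)
        rw [lam_rpow h] at this
        rw [div_le_iff₀ hA0]
        linarith [le_abs_self C])
  refine ⟨fun n t => A / g ^ n * Y t n, ?_, ?_, A, ?_⟩
  · intro n hn t ht
    obtain ⟨n, rfl⟩ := Nat.exists_eq_add_of_le' hn
    refine ((hY (n + 1) t ht).const_mul (A / g ^ (n + 1))).congr_deriv ?_
    rw [lam_rpow (Nat.succ_ne_zero n), ← hb, Nat.add_sub_cancel, field]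
    rcases Nat.eq_zero_or_pos n with rfl | hpos
    · simp only [hYz, pow_succ]
      field_simp
      ring
    · rw [lam_rpow hpos.ne', ← hb]
      simp only [pow_succ]
      field_simp
  · intro n hn
    have hn0 : n ≠ 0 := Nat.one_le_iff_ne_zero.1 hn
    simp only [hY0, if_neg hn0]
    field_simp
  · intro t _ n hn
    rw [lam_rpow (Nat.one_le_iff_ne_zero.1 hn), ← hg]
    calc g ^ n * (A / g ^ n * Y t n) = A * Y t n := by field_simp
      _ ≤ A := mul_le_of_le_one_right hA0.le (hY1 t n)
end
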